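/- arXiv:2103.07831 — 4 statements merged into one kernel-verified Lean document; each statement's English description precedes it below -/
import Mathlib

section
/- Under these hypotheses, for every multi-index n = (n₁,…,n_d) ∈ ℕ^d with Σn ≥ 1, the mixed partial derivative of the implicit zero satisfies ∂(φ,n) = F(Σ_{i=1}^d n_i γ_i, Σn − 1, 1), where F is formed from α and the Taylor coefficients c_k = g^{(k)}(α)/k! of the base function g at α. -/
open Finset Complex

noncomputable def fallFac (z : ℂ) (k : ℕ) : ℂ := ∏ j ∈ Finset.range k, (z - j)

noncomputable def gbinom (z : ℂ) (k : ℤ) : ℂ :=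
  if 0 ≤ k then fallFac z k.toNat / (Nat.factorial k.toNat) else 0

/-- Compositions of `r`: finitely supported sequences (μ₁, μ₂, …) of non-negative
integers summing to `r`, represented as tuples `μ : Fin (r+2) → ℕ` with `μ 0 = 0`
(so `μ i` is μ_i for `1 ≤ i ≤ r+1`; entries with index `> r+1` are necessarily 0
in any term that does not vanish). -/
def comps (r : ℕ) : Finset (Fin (r + 2) → ℕ) :=
  (Fintype.piFinset fun _ => Finset.range (r + 1)).filter
    fun μ => μ 0 = 0 ∧ ∑ i, μ i = r

/-- `FF α c x r a` is the quantity F(x, r, a) of the paper. -/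
noncomputable def FF (α : ℂ) (c : ℕ → ℂ) (x : ℂ) (r a : ℕ) : ℂ :=
  -α ^ x / ((Nat.factorial (a - 1)) : ℂ) *
    ∑ μ ∈ comps r,
      (-1 : ℂ) ^ μ 1 *
      gbinom x ((r : ℤ) - (∑ i : Fin (r + 2), ((i.val : ℤ) - 1) * μ i) - ((a : ℤ) - 1)) *
      ((Nat.factorial (r + ∑ i ∈ Finset.univ \ ({0, 1} : Finset (Fin (r + 2))), μ i)) : ℂ) *
      α ^ (-((r : ℤ) - (∑ i : Fin (r + 2), ((i.val : ℤ) - 1) * μ i) - ((a : ℤ) - 1))) *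
      c 1 ^ (-((r : ℤ) + 1 + ∑ i ∈ Finset.univ \ ({0, 1} : Finset (Fin (r + 2))), ((μ i : ℤ)))) *
      ∏ i ∈ Finset.univ \ ({0, 1} : Finset (Fin (r + 2))), (c i ^ μ i / ((Nat.factorial (μ i)) : ℂ))

/-- The partial derivative ∂/∂aᵢ of a function ℂ^d → ℂ. -/
noncomputable def pderivC {d : ℕ} (i : Fin d) (ψ : (Fin d → ℂ) → ℂ) :
    (Fin d → ℂ) → ℂ :=
  fun a => deriv (fun t => ψ (Function.update a i t)) (a i)

/-- The mixed partial derivative (∂/∂a₁)^{n₁} ⋯ (∂/∂a_d)^{n_d} ψ. -/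
noncomputable def mixedPartial {d : ℕ} (n : Fin d → ℕ) (ψ : (Fin d → ℂ) → ℂ) :
    (Fin d → ℂ) → ℂ :=
  ((List.ofFn fun i : Fin d => (pderivC i)^[n i]).foldr (· ∘ ·) id) ψ

theorem hasDerivAt_circleIntegral_div_pow {c : ℂ} {R : ℝ} (hR : 0 ≤ R) {u p q : ℂ → ℂ}
    (hu : ContinuousOn u (Metric.sphere c R)) (hp : ContinuousOn p (Metric.sphere c R))
    (hq : ContinuousOn q (Metric.sphere c R)) (h0 : ∀ z ∈ Metric.sphere c R, p z ≠ 0)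
    (k : ℕ) (t₀ : ℂ) :
    HasDerivAt (fun t => ∮ z in C(c, R), u z / (p z + (t - t₀) * q z) ^ k)
      (-(k : ℂ) * ∮ z in C(c, R), u z * q z / p z ^ (k + 1)) t₀ := by
  have hmem : ∀ θ, circleMap c R θ ∈ Metric.sphere c R := circleMap_mem_sphere c hR
  have hu' : Continuous fun θ => u (circleMap c R θ) :=
    hu.comp_continuous (continuous_circleMap c R) hmem
  have hp' : Continuous fun θ => p (circleMap c R θ) :=
    hp.comp_continuous (continuous_circleMap c R) hmem
  have hq' : Continuous fun θ => q (circleMap c R θ) :=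
    hq.comp_continuous (continuous_circleMap c R) hmem
  have hd : Continuous (deriv (circleMap c R)) := by
    simp only [funext (deriv_circleMap c R)]
    fun_prop
  let h : ℂ → ℝ → ℂ := fun t θ => p (circleMap c R θ) + (t - t₀) * q (circleMap c R θ)
  have hh : Continuous fun x : ℂ × ℝ => h x.1 x.2 := by
    exact (hp'.comp continuous_snd).add
      ((continuous_fst.sub continuous_const).mul (hq'.comp continuous_snd))
  have hev : ∀ᶠ t in nhds t₀, ∀ θ ∈ Set.uIcc 0 (2 * Real.pi), h t θ ≠ 0 := by
    refine isCompact_uIcc.eventually_forall_of_forall_eventually fun θ _ => ?_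
    refine hh.continuousAt.eventually_ne ?_
    simpa [h] using h0 _ (hmem θ)
  obtain ⟨ε, hε, hball⟩ := Metric.nhds_basis_closedBall.eventually_iff.1 hev
  let F' : ℂ → ℝ → ℂ := fun t θ => deriv (circleMap c R) θ *
    (-(k : ℂ) * (u (circleMap c R θ) * q (circleMap c R θ) / h t θ ^ (k + 1)))
  have hF' : ContinuousOn (fun x : ℂ × ℝ => F' x.1 x.2)
      (Metric.closedBall t₀ ε ×ˢ Set.uIcc 0 (2 * Real.pi)) := by
    dsimp only [F']
    refine (hd.comp continuous_snd).continuousOn.mul (continuousOn_const.mul ?_)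
    exact ((hu'.mul hq').comp continuous_snd).continuousOn.div (hh.pow _).continuousOn
      fun x hx => pow_ne_zero _ (hball hx.1 _ hx.2)
  obtain ⟨C, hC⟩ := ((isCompact_closedBall t₀ ε).prod isCompact_uIcc).exists_bound_of_continuousOn hF'
  have hcont : ∀ t ∈ Metric.closedBall t₀ ε, ContinuousOn
      (fun θ => deriv (circleMap c R) θ * (u (circleMap c R θ) / h t θ ^ k))
      (Set.uIcc 0 (2 * Real.pi)) := fun t ht =>
    hd.continuousOn.mul (hu'.continuousOn.div
      ((hh.comp (by fun_prop : Continuous fun θ : ℝ => (t, θ))).pow k).continuousOn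
      fun θ hθ => pow_ne_zero _ (hball ht _ hθ))
  have hF'c : ContinuousOn (F' t₀) (Set.uIcc 0 (2 * Real.pi)) :=
    hF'.comp (by fun_prop : ContinuousOn (fun θ : ℝ => (t₀, θ)) _)
      fun θ hθ => ⟨Metric.mem_closedBall_self hε.le, hθ⟩
  have key := (intervalIntegral.hasDerivAt_integral_of_dominated_loc_of_deriv_le
    (μ := MeasureTheory.volume) (a := 0) (b := 2 * Real.pi) (bound := fun _ => C)
    (F := fun t θ => deriv (circleMap c R) θ * (u (circleMap c R θ) / h t θ ^ k)) (F' := F')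
    (Metric.closedBall_mem_nhds t₀ hε) ?_ ?_ ?_ ?_ ?_ ?_).2
  · refine key.congr_deriv ?_
    rw [circleIntegral, ← intervalIntegral.integral_const_mul]
    refine intervalIntegral.integral_congr fun θ _ => ?_
    simp only [F', h, sub_self, zero_mul, add_zero, smul_eq_mul]
    ring
  · filter_upwards [Metric.closedBall_mem_nhds t₀ hε] with t ht
    exact ((hcont t ht).mono Set.uIoc_subset_uIcc).aestronglyMeasurable measurableSet_uIoc
  · exact (hcont t₀ (Metric.mem_closedBall_self hε.le)).intervalIntegrable
  · exact (hF'c.mono Set.uIoc_subset_uIcc).aestronglyMeasurable measurableSet_uIoc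
  · exact .of_forall fun θ hθ t ht => hC (t, θ) ⟨ht, Set.uIoc_subset_uIcc hθ⟩
  · exact intervalIntegrable_const
  · refine .of_forall fun θ hθ t ht => ?_
    have hne : h t θ ≠ 0 := hball ht _ (Set.uIoc_subset_uIcc hθ)
    have h1 : HasDerivAt (fun t => h t θ) (q (circleMap c R θ)) t := by
      simpa only [id, one_mul] using
        (((hasDerivAt_id t).sub_const t₀).mul_const (q (circleMap c R θ))).const_add
          (p (circleMap c R θ))
    have h2 := (((h1.pow k).inv (pow_ne_zero _ hne)).const_mul (u (circleMap c R θ))).const_mul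
      (deriv (circleMap c R) θ)
    refine (h2.congr_deriv ?_).congr_of_eventuallyEq (.of_forall fun t => by simp [div_eq_mul_inv])
    rcases k with _ | k
    · simp [F']
    · simp only [F', Nat.add_sub_cancel, Pi.pow_apply]
      field_simp
      ring

/-- The residue at a simple zero `w` of `p`. -/
theorem circleIntegral_div_of_simple_zero {c w : ℂ} {R R' : ℝ} (hRR' : R < R') {u p : ℂ → ℂ}
    (hu : DifferentiableOn ℂ u (Metric.ball c R')) (hp : DifferentiableOn ℂ p (Metric.ball c R'))
    (hw : w ∈ Metric.ball c R) (hpw : p w = 0) (hpw' : deriv p w ≠ 0)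
    (hne : ∀ z ∈ Metric.ball c R', p z = 0 → z = w) :
    ∮ z in C(c, R), u z / p z = 2 * Real.pi * I * (u w / deriv p w) := by
  have hR : 0 < R := Metric.pos_of_mem_ball hw
  have hsub : Metric.closedBall c R ⊆ Metric.ball c R' := Metric.closedBall_subset_ball hRR'
  have hw' : w ∈ Metric.ball c R' := hsub (Metric.ball_subset_closedBall hw)
  have hq : DifferentiableOn ℂ (dslope p w) (Metric.ball c R') :=
    (differentiableOn_dslope (Metric.isOpen_ball.mem_nhds hw')).2 hp
  have hq0 : ∀ z ∈ Metric.ball c R', dslope p w z ≠ 0 := by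
    intro z hz
    rcases eq_or_ne z w with rfl | hzw
    · rwa [dslope_same]
    · rw [dslope_of_ne _ hzw, slope_def_field, hpw, sub_zero]
      exact div_ne_zero (fun h => hzw (hne z hz h)) (sub_ne_zero.2 hzw)
  have hquot : DiffContOnCl ℂ (fun z => u z / dslope p w z) (Metric.ball c R) := by
    refine DifferentiableOn.diffContOnCl ?_
    rw [closure_ball c hR.ne']
    exact (hu.div hq hq0).mono hsub
  have key := hquot.circleIntegral_sub_inv_smul hw
  rw [dslope_same] at key
  rw [← smul_eq_mul, ← key]
  refine circleIntegral.integral_congr hR.le fun z hz => ?_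
  have hzw : z ≠ w := fun h => (Metric.mem_ball.1 hw).ne (h ▸ hz)
  have : p z = (z - w) * dslope p w z := by
    have := sub_smul_dslope p w z
    rw [smul_eq_mul, hpw, sub_zero] at this
    exact this.symm
  simp only [smul_eq_mul]
  rw [this]
  have := hq0 z (hsub (Metric.sphere_subset_closedBall hz))
  have := sub_ne_zero.2 hzw
  field_simp

theorem eventually_update {d : ℕ} {V : Set (Fin d → ℂ)} (hV : IsOpen V) {a : Fin d → ℂ}
    (ha : a ∈ V) (i : Fin d) : ∀ᶠ t in nhds (a i), Function.update a i t ∈ V := by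
  have hc : ContinuousAt (fun t => Function.update a i t) (a i) :=
    (continuous_const.update i continuous_id).continuousAt
  exact hc (by simpa using hV.mem_nhds ha)

theorem pderivC_eqOn {d : ℕ} {V : Set (Fin d → ℂ)} (hV : IsOpen V) {ψ χ : (Fin d → ℂ) → ℂ}
    (h : Set.EqOn ψ χ V) (i : Fin d) : Set.EqOn (pderivC i ψ) (pderivC i χ) V := fun _ ha =>
  Filter.EventuallyEq.deriv_eq ((eventually_update hV ha i).mono fun _ ht => h ht)

/-- A family `J` of functions indexed by multi-indices, whose partial derivatives shift the index,
computes the mixed partial derivatives of `J 0`. -/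
theorem mixedPartial_eqOn {d : ℕ} {V : Set (Fin d → ℂ)} (hV : IsOpen V)
    {J : (Fin d → ℕ) → (Fin d → ℂ) → ℂ}
    (hJ : ∀ m i, Set.EqOn (pderivC i (J m)) (J (m + Pi.single i 1)) V) (n : Fin d → ℕ) :
    Set.EqOn (mixedPartial n (J 0)) (J n) V := by
  have hiter : ∀ i k m ψ, Set.EqOn ψ (J m) V →
      Set.EqOn ((pderivC i)^[k] ψ) (J (m + Pi.single i k)) V := by
    intro i k
    induction k with
    | zero => intro m ψ h; simpa using h
    | succ k ih =>
      intro m ψ h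
      rw [Function.iterate_succ_apply]
      have := ih _ _ ((pderivC_eqOn hV h i).trans (hJ m i))
      rwa [add_assoc, ← Pi.single_add, add_comm 1 k] at this
  have hlist : ∀ l : List (Fin d), Set.EqOn
      (((l.map fun i => (pderivC i)^[n i]).foldr (· ∘ ·) id) (J 0))
      (J (l.map fun i => Pi.single i (n i)).sum) V := by
    intro l
    induction l with
    | nil => simp [Set.EqOn]
    | cons i l ih =>
      simp only [List.map_cons, List.foldr_cons, List.sum_cons, Function.comp_apply]
      rw [add_comm]
      exact hiter i (n i) _ _ ih
  have := hlist (List.finRange d)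
  rw [← List.ofFn_eq_map, ← List.ofFn_eq_map, List.sum_ofFn, Finset.univ_sum_single] at this
  exact this

/-- A solution of `g (φ a) + ∑ i, a i * G i (φ a) = 0` is, for small `a`, the only zero of
`g + ∑ i, a i * G i` near `φ 0`, and it is simple. -/
theorem exists_unique_simple_zero {d : ℕ} {α : ℂ} {g : ℂ → ℂ} (hg : AnalyticAt ℂ g α)
    (hg' : deriv g α ≠ 0) {G : Fin d → ℂ → ℂ} (hG : ∀ i, AnalyticAt ℂ (G i) α)
    {φ : (Fin d → ℂ) → ℂ} (hφ : ContinuousAt φ 0) (hφ0 : φ 0 = α)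
    (hzero : ∀ᶠ a in nhds 0, g (φ a) + ∑ i, a i * G i (φ a) = 0) :
    ∃ R R' : ℝ, 0 < R ∧ R < R' ∧ DifferentiableOn ℂ g (Metric.ball α R') ∧
      (∀ i, DifferentiableOn ℂ (G i) (Metric.ball α R')) ∧
      ∀ᶠ a in nhds 0, φ a ∈ Metric.ball α R ∧
        deriv (fun z => g z + ∑ i, a i * G i z) (φ a) ≠ 0 ∧
        ∀ z ∈ Metric.ball α R', g z + ∑ i, a i * G i z = 0 → z = φ a := by
  let D : (Fin d → ℂ) → ℂ → ℂ := fun a z => deriv g z + ∑ i, a i * deriv (G i) z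
  have hD : ContinuousAt (fun x : (Fin d → ℂ) × ℂ => D x.1 x.2) (0, α) := by
    refine (hg.deriv.continuousAt.comp_of_eq continuousAt_snd rfl).add ?_
    refine tendsto_finsetSum _ fun i _ => ?_
    exact ((continuous_apply i).continuousAt.comp continuousAt_fst).mul
      ((hG i).deriv.continuousAt.comp_of_eq continuousAt_snd rfl)
  have hc : 0 < ‖deriv g α‖ / 2 := half_pos (norm_pos_iff.2 hg')
  have hclose : ∀ᶠ x : (Fin d → ℂ) × ℂ in nhds 0 ×ˢ nhds α,
      ‖D x.1 x.2 - deriv g α‖ < ‖deriv g α‖ / 2 := by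
    rw [← nhds_prod_eq]
    filter_upwards [hD (Metric.ball_mem_nhds _ hc)] with x hx
    simpa [D, dist_eq_norm] using hx
  obtain ⟨pa, hpa, pz, hpz, hclose⟩ := Filter.eventually_prod_iff.1 hclose
  obtain ⟨R', hR', hball⟩ := Metric.eventually_nhds_iff_ball.1
    (hpz.and (hg.eventually_analyticAt.and
      (Filter.eventually_all.2 fun i => (hG i).eventually_analyticAt)))
  refine ⟨R' / 2, R', half_pos hR', half_lt_self hR',
    fun z hz => (hball z hz).2.1.differentiableAt.differentiableWithinAt,
    fun i z hz => ((hball z hz).2.2 i).differentiableAt.differentiableWithinAt, ?_⟩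
  filter_upwards [hpa, hzero, hφ (by rw [hφ0]; exact Metric.ball_mem_nhds α (half_pos hR'))]
    with a ha hza hφa
  have hφa' : φ a ∈ Metric.ball α R' := Metric.ball_subset_ball (half_lt_self hR').le hφa
  have hP : ∀ z ∈ Metric.ball α R', HasDerivAt (fun z => g z + ∑ i, a i * G i z) (D a z) z :=
    fun z hz => (hball z hz).2.1.differentiableAt.hasDerivAt.add
      (HasDerivAt.fun_sum fun i _ =>
        ((hball z hz).2.2 i).differentiableAt.hasDerivAt.const_mul (a i))
  have hDa : ∀ z ∈ Metric.ball α R', ‖D a z - deriv g α‖ ≤ ‖deriv g α‖ / 2 :=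
    fun z hz => (hclose ha (hball z hz).1).le
  refine ⟨hφa, ?_, fun z hz hzz => ?_⟩
  · rw [(hP _ hφa').deriv]
    intro h0
    have := hDa _ hφa'
    rw [h0, zero_sub, norm_neg] at this
    linarith
  · have hlip := (convex_ball α R').norm_image_sub_le_of_norm_hasDerivWithin_le
      (f := fun z => (g z + ∑ i, a i * G i z) - deriv g α * z)
      (fun z hz => (((hP z hz).sub (((hasDerivAt_id z).const_mul (deriv g α)))).congr_deriv
        (by rw [mul_one])).hasDerivWithinAt) hDa hz hφa'
    simp only [hzz, hza, zero_sub, sub_neg_eq_add] at hlip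
    rw [neg_add_eq_sub, ← mul_sub, norm_mul, norm_sub_rev z] at hlip
    have : ‖φ a - z‖ ≤ 0 := by nlinarith [norm_nonneg (φ a - z)]
    exact (sub_eq_zero.1 (norm_le_zero_iff.1 this)).symm

theorem sum_update_mul {d : ℕ} (a b : Fin d → ℂ) (i : Fin d) (t : ℂ) :
    ∑ j, Function.update a i t j * b j = ∑ j, a j * b j + (t - a i) * b i := by
  have h : ∀ j, Function.update a i t j * b j =
      a j * b j + if j = i then (t - a i) * b i else 0 := by
    intro j
    rcases eq_or_ne j i with rfl | hj
    · simp only [Function.update_self, if_true]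
      ring
    · simp [hj]
  simp [h, Finset.sum_add_distrib]

/-- The partial derivatives of an implicit function. -/
theorem pderivC_implicit {d : ℕ} {g : ℂ → ℂ} {G : Fin d → ℂ → ℂ}
    {φ : (Fin d → ℂ) → ℂ} {a : Fin d → ℂ} (hφ : DifferentiableAt ℂ φ a)
    (hg : DifferentiableAt ℂ g (φ a)) (hG : ∀ i, DifferentiableAt ℂ (G i) (φ a))
    (hzero : ∀ᶠ b in nhds a, g (φ b) + ∑ i, b i * G i (φ b) = 0)
    (hne : deriv (fun z => g z + ∑ i, a i * G i z) (φ a) ≠ 0) (i : Fin d) :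
    pderivC i φ a = -(G i (φ a) / deriv (fun z => g z + ∑ i, a i * G i z) (φ a)) := by
  have hupd : Function.update a i (a i) = a := Function.update_eq_self i a
  have hx : HasDerivAt (fun t => φ (Function.update a i t)) (pderivC i φ a) (a i) := by
    refine DifferentiableAt.hasDerivAt ?_
    exact DifferentiableAt.comp (a i) (by rwa [hupd]) (hasDerivAt_update a i (a i)).differentiableAt
  have hP : HasDerivAt (fun z => g z + ∑ i, a i * G i z)
      (deriv (fun z => g z + ∑ i, a i * G i z) (φ a)) (φ a) :=
    (hg.add (DifferentiableAt.fun_sum fun j _ => (hG j).const_mul (a j))).hasDerivAt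
  have h1 := (HasDerivAt.comp_of_eq (a i) hP hx (by rw [hupd])).add
    (((hasDerivAt_id (a i)).sub_const (a i)).mul
      (HasDerivAt.comp_of_eq (a i) (hG i).hasDerivAt hx (by rw [hupd])))
  have hc : ContinuousAt (fun t => Function.update a i t) (a i) :=
    (continuous_const.update i continuous_id).continuousAt
  have h2 := hc.eventually (p := fun b => g (φ b) + ∑ i, b i * G i (φ b) = 0) (by simpa only [hupd] using hzero)
  have h3 := h1.unique ((hasDerivAt_const (a i) (0 : ℂ)).congr_of_eventuallyEq
    (h2.mono fun t ht => by
      rw [sum_update_mul a] at ht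
      simp only [Pi.add_apply, Pi.mul_apply, Function.comp_apply, id]
      rw [← ht]
      ring))
  simp only [id, sub_self, one_mul, zero_mul, add_zero, Function.comp_apply, hupd] at h3
  rw [eq_neg_iff_add_eq_zero, eq_comm, ← mul_right_inj' hne, mul_zero, ← h3]
  field_simp

theorem mixedPartial_implicit {d : ℕ} {α : ℂ} {g : ℂ → ℂ} (hg : AnalyticAt ℂ g α)
    (hgα : g α = 0) (hg' : deriv g α ≠ 0) {G : Fin d → ℂ → ℂ} (hG : ∀ i, AnalyticAt ℂ (G i) α)
    {φ : (Fin d → ℂ) → ℂ} (hφ : ∀ᶠ a in nhds 0, DifferentiableAt ℂ φ a) (hφ0 : φ 0 = α)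
    (hzero : ∀ᶠ a in nhds 0, g (φ a) + ∑ i, a i * G i (φ a) = 0) (n : Fin d → ℕ) {r : ℕ}
    (hn : ∑ i, n i = r + 1) :
    mixedPartial n φ 0 =
      (-1) ^ (r + 1) * iteratedDeriv r (fun z => (∏ i, G i z ^ n i) / dslope g α z ^ (r + 1)) α := by
  obtain ⟨R, R', hR, hRR', hgd, hGd, hev⟩ :=
    exists_unique_simple_zero hg hg' hG hφ.self_of_nhds.continuousAt hφ0 hzero
  obtain ⟨V, hV, hVo, h0V⟩ := eventually_nhds_iff.1 (hφ.and (hzero.and hev))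
  let P : (Fin d → ℂ) → ℂ → ℂ := fun a z => g z + ∑ i, a i * G i z
  have hsub : Metric.closedBall α R ⊆ Metric.ball α R' := Metric.closedBall_subset_ball hRR'
  have hS : Metric.sphere α R ⊆ Metric.ball α R' := Metric.sphere_subset_closedBall.trans hsub
  have hPd : ∀ a, DifferentiableOn ℂ (P a) (Metric.ball α R') := fun a =>
    hgd.add (DifferentiableOn.fun_sum fun i _ => (hGd i).const_mul (a i))
  have hprod : ∀ m : Fin d → ℕ, DifferentiableOn ℂ (fun z => ∏ i, G i z ^ m i) (Metric.ball α R') :=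
    fun m => DifferentiableOn.fun_finsetProd fun i _ => (hGd i).pow (m i)
  have hP0 : ∀ a ∈ V, ∀ z ∈ Metric.sphere α R, P a z ≠ 0 := by
    intro a ha z hz hz0
    have hφa := (hV a ha).2.2.1
    rw [← (hV a ha).2.2.2.2 z (hS hz) hz0] at hφa
    exact (Metric.mem_ball.1 hφa).ne hz
  let J : (Fin d → ℕ) → (Fin d → ℂ) → ℂ := fun m a => if m = 0 then φ a else
    (-1) ^ (∑ i, m i) * ((∑ i, m i) - 1).factorial / (2 * Real.pi * I) *
      ∮ z in C(α, R), (∏ i, G i z ^ m i) / P a z ^ (∑ i, m i)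
  have hJ : ∀ m i, Set.EqOn (pderivC i (J m)) (J (m + Pi.single i 1)) V := by
    intro m i a ha
    have hne : m + Pi.single i 1 ≠ 0 := fun h => by simpa using congrFun h i
    have hsum : ∑ j, (m + Pi.single i 1 : Fin d → ℕ) j = ∑ j, m j + 1 := by
      simp [Finset.sum_add_distrib]
    have hprod1 : ∀ z, ∏ j, G j z ^ (m + Pi.single i 1 : Fin d → ℕ) j = (∏ j, G j z ^ m j) * G i z := by
      intro z
      simp only [Pi.add_apply, pow_add, Finset.prod_mul_distrib]
      congr 1
      rw [Finset.prod_eq_single i] <;> simp +contextual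
    obtain ⟨hφa, hza, hφball, hder, huniq⟩ := hV a ha
    have hφball' := hsub (Metric.ball_subset_closedBall hφball)
    have hnhds := Metric.isOpen_ball.mem_nhds hφball'
    simp only [J, if_neg hne, hsum, hprod1, Nat.add_sub_cancel]
    rcases eq_or_ne m 0 with rfl | hm
    · have hres := circleIntegral_div_of_simple_zero hRR' (hGd i) (hPd a) hφball hza hder huniq
      simp only [if_true, Pi.zero_apply, Finset.sum_const_zero, pow_zero, Finset.prod_const_one,
        one_mul, zero_add, pow_one, Nat.factorial_zero, Nat.cast_one]
      rw [hres]
      refine (pderivC_implicit hφa (hgd.differentiableAt hnhds)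
        (fun j => (hGd j).differentiableAt hnhds) ?_ hder i).trans ?_
      · filter_upwards [hVo.mem_nhds ha] with b hb using (hV b hb).2.1
      · have := Complex.two_pi_I_ne_zero
        simp only [P]
        field_simp
    · simp only [if_neg hm]
      have hpar := (hasDerivAt_circleIntegral_div_pow hR.le ((hprod m).continuousOn.mono hS)
        ((hPd a).continuousOn.mono hS) ((hGd i).continuousOn.mono hS) (hP0 a ha)
        (∑ j, m j) (a i)).const_mul
          ((-1) ^ (∑ i, m i) * ((∑ i, m i) - 1).factorial / (2 * Real.pi * I))
      have hupd : ∀ t z, P (Function.update a i t) z = P a z + (t - a i) * G i z := by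
        intro t z
        simp only [P, sum_update_mul a]
        ring
      simp only [pderivC, hupd]
      rw [hpar.deriv]
      obtain ⟨k, hk⟩ : ∃ k, ∑ j, m j = k + 1 := Nat.exists_eq_succ_of_ne_zero fun h =>
        hm (funext fun j => by simpa using Finset.sum_eq_zero_iff.1 h j (mem_univ j))
      rw [hk, Nat.add_sub_cancel, Nat.factorial_succ]
      push_cast
      ring
  have hn0 : n ≠ 0 := by
    rintro rfl
    simp at hn
  have hφJ : φ = J 0 := by
    funext a
    simp [J]
  have hα : α ∈ Metric.ball α R' := Metric.mem_ball_self (hR.trans hRR')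
  have hh : DifferentiableOn ℂ (dslope g α) (Metric.ball α R') :=
    (differentiableOn_dslope (Metric.isOpen_ball.mem_nhds hα)).2 hgd
  have hgz : ∀ z, g z = (z - α) * dslope g α z := fun z => by
    have := sub_smul_dslope g α z
    rw [smul_eq_mul, hgα, sub_zero] at this
    exact this.symm
  have hh0 : ∀ z ∈ Metric.ball α R', dslope g α z ≠ 0 := by
    intro z hz h0
    have hzα := (hV 0 h0V).2.2.2.2 z hz (by simp [hgz z, h0])
    rw [hφ0] at hzα
    rw [hzα, dslope_same] at h0
    exact hg' h0
  have hcauchy := DifferentiableOn.circleIntegral_one_div_sub_center_pow_smul hR r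
    (((hprod n).div (hh.pow (r + 1)) fun z hz => pow_ne_zero _ (hh0 z hz)).mono hsub)
  rw [hφJ, mixedPartial_eqOn hVo hJ n h0V]
  simp only [J, if_neg hn0, hn, Nat.add_sub_cancel]
  have hint : ∮ z in C(α, R), (∏ i, G i z ^ n i) / P 0 z ^ (r + 1) =
      (2 * Real.pi * I / r.factorial) *
        iteratedDeriv r (fun z => (∏ i, G i z ^ n i) / dslope g α z ^ (r + 1)) α := by
    refine Eq.trans ?_ hcauchy
    refine circleIntegral.integral_congr hR.le fun z _ => ?_
    simp [P, hgz z, mul_pow, div_eq_mul_inv, mul_comm, mul_assoc, mul_left_comm]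
  rw [hint]
  have := Complex.two_pi_I_ne_zero
  have : (r.factorial : ℂ) ≠ 0 := Nat.cast_ne_zero.2 r.factorial_ne_zero
  field_simp

theorem one_sub_mul_sum_choose {A : Type*} [CommRing A] (Y : A) (N K : ℕ) :
    (1 - Y) * ∑ m ∈ range K, ((N + 1 + m).choose (N + 1) : A) * Y ^ m =
      ∑ m ∈ range K, ((N + m).choose N : A) * Y ^ m - ((N + K).choose (N + 1) : A) * Y ^ K := by
  induction K with
  | zero => simp
  | succ K ih =>
    have h : ((N + 1 + K).choose (N + 1) : A) =
        (N + K).choose N + (N + K).choose (N + 1) := by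
      rw [show N + 1 + K = N + K + 1 by ring, Nat.choose_succ_succ]
      push_cast
      ring
    rw [sum_range_succ, sum_range_succ, mul_add, ih, show N + (K + 1) = N + 1 + K by ring, h]
    ring

/-- The partial sums of the binomial series invert `(1 - Y) ^ (N + 1)` modulo `Y ^ K`. -/
theorem pow_dvd_one_sub_pow_mul_sum_choose {A : Type*} [CommRing A] (Y : A) (N K : ℕ) :
    Y ^ K ∣ (1 - Y) ^ (N + 1) * ∑ m ∈ range K, ((N + m).choose N : A) * Y ^ m - 1 := by
  induction N with
  | zero =>
    have := mul_neg_geom_sum Y K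
    simp [this]
  | succ N ih =>
    rw [pow_succ, mul_assoc, one_sub_mul_sum_choose, mul_sub, sub_right_comm]
    exact dvd_sub ih (Dvd.intro_left _ (mul_assoc _ _ _))

theorem PowerSeries.coeff_eq_of_X_pow_dvd_sub {A : Type*} [CommRing A] {f g : PowerSeries A}
    {r : ℕ} (h : PowerSeries.X ^ (r + 1) ∣ f - g) :
    PowerSeries.coeff r f = PowerSeries.coeff r g := by
  have := PowerSeries.X_pow_dvd_iff.1 h r (Nat.lt_succ_self r)
  rwa [map_sub, sub_eq_zero] at this

theorem Fin.sum_eq_add_sum_sdiff {M : Type*} [AddCommMonoid M] {r : ℕ} (f : Fin (r + 2) → M) :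
    ∑ i, f i = f 0 + f 1 + ∑ i ∈ univ \ ({0, 1} : Finset (Fin (r + 2))), f i := by
  rw [← sum_sdiff (subset_univ ({0, 1} : Finset (Fin (r + 2)))), sum_pair (by simp), add_comm]

open PowerSeries in
/-- The last coefficient that the truncated expansion of `H ^ (-(r + 1))` determines in
`A * H ^ (-(r + 1))`, by the multinomial theorem. -/
theorem PowerSeries.coeff_of_mul_pow_eq {r : ℕ} {A F H : PowerSeries ℂ} {c : ℕ → ℂ}
    (hH : ∀ k, coeff k H = c (k + 1)) (hc : c 1 ≠ 0) (h : F * H ^ (r + 1) = A) :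
    coeff r F = ∑ m ∈ range (r + 1),
      ∑ μ ∈ piAntidiag (univ \ ({0, 1} : Finset (Fin (r + 2)))) m,
        (-1) ^ m * ((r + m).choose r : ℂ) * (c 1 ^ (r + 1 + m))⁻¹ *
          (Nat.multinomial (univ \ ({0, 1} : Finset (Fin (r + 2)))) μ *
            ∏ i ∈ univ \ ({0, 1} : Finset (Fin (r + 2))), c i ^ μ i) *
          coeff r (A * X ^ (∑ i ∈ univ \ ({0, 1} : Finset (Fin (r + 2))), (i.val - 1) * μ i)) := by
  set S := univ \ ({0, 1} : Finset (Fin (r + 2)))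
  let B : PowerSeries ℂ := ∑ i ∈ S, C (c i) * X ^ (i.val - 1)
  let Y : PowerSeries ℂ := 1 - C (c 1)⁻¹ * H
  let Z : PowerSeries ℂ := -(C (c 1)⁻¹ * B)
  have hcc : C (c 1)⁻¹ * C (c 1) = 1 := by rw [← map_mul, inv_mul_cancel₀ hc, map_one]
  have hY : X ∣ Y := by
    rw [X_dvd_iff]
    rw [← coeff_zero_eq_constantCoeff_apply, map_sub, coeff_C_mul, hH, zero_add,
      inv_mul_cancel₀ hc, coeff_zero_one, sub_self]
  have hHB : X ^ (r + 1) ∣ H - (C (c 1) + B) := by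
    rw [X_pow_dvd_iff]
    intro k hk
    have hsum : C (c 1) + B = ∑ i : Fin (r + 1), C (c (i + 1)) * X ^ i.val := by
      have := Fin.sum_eq_add_sum_sdiff fun i : Fin (r + 2) =>
        if i = 0 then 0 else C (c i) * (X : PowerSeries ℂ) ^ (i.val - 1)
      rw [Fin.sum_univ_succ] at this
      simp only [if_true, Fin.succ_ne_zero, if_false, zero_add, Fin.val_succ,
        Nat.add_sub_cancel] at this
      rw [this]
      congr 1
      · simp
      · refine sum_congr rfl fun i hi => ?_
        rw [if_neg]
        rintro rfl
        simp at hi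
    rw [hsum, map_sub, hH, map_sum, sum_eq_single ⟨k, hk⟩]
    · simp
    · intro i _ hi
      rw [coeff_C_mul_X_pow, if_neg]
      rintro rfl
      exact hi rfl
    · simp
  have hYZ : X ^ (r + 1) ∣ Y - Z := by
    have : Y - Z = -(C (c 1)⁻¹) * (H - (C (c 1) + B)) := by
      simp only [Y, Z]
      linear_combination (-1 : PowerSeries ℂ) * hcc
    rw [this]
    exact hHB.mul_left _
  have hF : X ^ (r + 1) ∣ (C (c 1)⁻¹) ^ (r + 1) * A *
      ∑ m ∈ range (r + 1), ((r + m).choose r : PowerSeries ℂ) * Z ^ m - F := by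
    have h1 := ((pow_dvd_pow_of_dvd hY (r + 1)).trans
      (pow_dvd_one_sub_pow_mul_sum_choose Y r (r + 1))).mul_left F
    have h2 : X ^ (r + 1) ∣ (C (c 1)⁻¹) ^ (r + 1) * A *
        ∑ m ∈ range (r + 1), ((r + m).choose r : PowerSeries ℂ) * (Y ^ m - Z ^ m) :=
      (dvd_sum fun m _ => (hYZ.trans (sub_dvd_pow_sub_pow Y Z m)).mul_left _).mul_left _
    convert dvd_sub h1 h2 using 1
    rw [show 1 - Y = C (c 1)⁻¹ * H by simp [Y], mul_pow, ← h]
    simp only [mul_sub, sum_sub_distrib]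
    ring
  rw [← coeff_eq_of_X_pow_dvd_sub hF, mul_sum, map_sum]
  refine sum_congr rfl fun m _ => ?_
  have hB : B ^ m = ∑ μ ∈ piAntidiag S m,
      C ((Nat.multinomial S μ : ℂ) * ∏ i ∈ S, c i ^ μ i) * X ^ (∑ i ∈ S, (i.val - 1) * μ i) := by
    simp only [B]
    rw [sum_pow_eq_sum_piAntidiag]
    refine sum_congr rfl fun μ _ => ?_
    simp only [mul_pow, prod_mul_distrib, map_mul, map_prod, map_pow, map_natCast, ← pow_mul,
      prod_pow_eq_pow_sum, mul_assoc]
  have hterm : (C (c 1)⁻¹) ^ (r + 1) * A * (((r + m).choose r : PowerSeries ℂ) * Z ^ m) =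
      ∑ μ ∈ piAntidiag S m, C ((-1) ^ m * ((r + m).choose r : ℂ) * (c 1 ^ (r + 1 + m))⁻¹ *
          (Nat.multinomial S μ * ∏ i ∈ S, c i ^ μ i)) *
          (A * X ^ (∑ i ∈ S, (i.val - 1) * μ i)) := by
    have : Z ^ m = C ((-1) ^ m) * C (c 1)⁻¹ ^ m * B ^ m := by
      simp only [Z, neg_pow (C (c 1)⁻¹ * B), mul_pow, map_pow, map_neg, map_one, mul_assoc]
    rw [this, hB, mul_sum, mul_sum, mul_sum]
    refine sum_congr rfl fun μ _ => ?_
    simp only [map_mul, map_natCast, ← inv_pow, map_pow]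
    ring
  rw [hterm, map_sum]
  exact sum_congr rfl fun μ _ => coeff_C_mul _ _ _

theorem sum_comps {M : Type*} [AddCommMonoid M] (r : ℕ) (f : (Fin (r + 2) → ℕ) → M) :
    ∑ μ ∈ comps r, f μ = ∑ m ∈ range (r + 1),
      ∑ ν ∈ piAntidiag (univ \ ({0, 1} : Finset (Fin (r + 2)))) m,
        f (Function.update ν 1 (r - m)) := by
  set S := univ \ ({0, 1} : Finset (Fin (r + 2)))
  have h1 : ∀ i ∈ S, i ≠ 1 := by
    rintro i hi rfl
    simp [S] at hi
  have hupd : ∀ (ν : Fin (r + 2) → ℕ) k, ∑ i ∈ S, Function.update ν 1 k i = ∑ i ∈ S, ν i :=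
    fun ν k => sum_congr rfl fun i hi => Function.update_of_ne (h1 i hi) _ _
  have hcomps : ∀ μ : Fin (r + 2) → ℕ, μ ∈ comps r ↔ μ 0 = 0 ∧ μ 1 + ∑ i ∈ S, μ i = r := by
    intro μ
    have hsplit := Fin.sum_eq_add_sum_sdiff μ
    simp only [comps, mem_filter, Fintype.mem_piFinset, Finset.mem_range]
    constructor
    · rintro ⟨-, h0, hr⟩
      exact ⟨h0, by rw [hsplit, h0, zero_add] at hr; exact hr⟩
    · rintro ⟨h0, hr⟩
      have hr' : ∑ i, μ i = r := by rw [hsplit, h0, zero_add, hr]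
      exact ⟨fun i => Nat.lt_succ_of_le (hr' ▸ single_le_sum (fun _ _ => Nat.zero_le _)
        (mem_univ i)), h0, hr'⟩
  rw [sum_sigma']
  symm
  refine sum_nbij' (fun x => Function.update x.2 1 (r - x.1))
    (fun μ => ⟨∑ i ∈ S, μ i, Function.update μ 1 0⟩) ?_ ?_ ?_ ?_ ?_
  · rintro ⟨m, ν⟩ hx
    simp only [mem_sigma, Finset.mem_range, mem_piAntidiag] at hx
    obtain ⟨hm, hν, hsupp⟩ := hx
    have hν0 : ν 0 = 0 := by
      by_contra h
      simpa [S] using hsupp 0 h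
    rw [hcomps, hupd, hν, Function.update_self, Function.update_of_ne (by simp)]
    exact ⟨hν0, Nat.sub_add_cancel (Nat.lt_succ_iff.1 hm)⟩
  · intro μ hμ
    obtain ⟨h0, hr⟩ := (hcomps μ).1 hμ
    simp only [mem_sigma, Finset.mem_range, mem_piAntidiag, hupd, true_and]
    refine ⟨by omega, fun i hi => ?_⟩
    by_contra hiS
    have : i = 0 ∨ i = 1 := by
      by_contra hh
      exact hiS (by simpa [S] using hh)
    rcases this with rfl | rfl
    · rw [Function.update_of_ne (by simp)] at hi
      exact hi h0
    · simp at hi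
  · rintro ⟨m, ν⟩ hx
    simp only [mem_sigma, Finset.mem_range, mem_piAntidiag] at hx
    obtain ⟨hm, hν, hsupp⟩ := hx
    have hν1 : ν 1 = 0 := by
      by_contra h
      exact h1 1 (hsupp 1 h) rfl
    simp only [hupd, hν, Function.update_idem]
    rw [← hν1, Function.update_eq_self]
  · intro μ hμ
    obtain ⟨h0, hr⟩ := (hcomps μ).1 hμ
    simp only [Function.update_idem]
    rw [show r - ∑ i ∈ S, μ i = μ 1 by omega, Function.update_eq_self]
  · intro x _
    rfl

open PowerSeries in
/-- `FF` at `a = 1` is a Taylor coefficient of `z ^ x / H ^ (r + 1)`. -/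
theorem FF_eq_coeff {α : ℂ} (hα : α ≠ 0) {r : ℕ} {x : ℂ} {A F H : PowerSeries ℂ} {c : ℕ → ℂ}
    (hA : ∀ k, coeff k A = fallFac x k * α ^ (x - k) / k.factorial)
    (hH : ∀ k, coeff k H = c (k + 1)) (hc : c 1 ≠ 0) (h : F * H ^ (r + 1) = A) :
    FF α c x r 1 = (-1) ^ (r + 1) * r.factorial * coeff r F := by
  rw [coeff_of_mul_pow_eq hH hc h, FF, sum_comps, mul_sum, mul_sum]
  refine sum_congr rfl fun m hm => ?_
  rw [mul_sum, mul_sum]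
  refine sum_congr rfl fun ν hν => ?_
  set S := univ \ ({0, 1} : Finset (Fin (r + 2)))
  rw [mem_piAntidiag] at hν
  obtain ⟨hν, hsupp⟩ := hν
  have hmr : m ≤ r := Nat.lt_succ_iff.1 (Finset.mem_range.1 hm)
  have h0 : ∀ i ∈ S, i ≠ 0 := by
    rintro i hi rfl
    simp [S] at hi
  have h1 : ∀ i ∈ S, i ≠ 1 := by
    rintro i hi rfl
    simp [S] at hi
  have hν0 : ν 0 = 0 := by
    by_contra h
    exact h0 0 (hsupp 0 h) rfl
  have hupd : ∀ i ∈ S, Function.update ν 1 (r - m) i = ν i :=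
    fun i hi => Function.update_of_ne (h1 i hi) _ _
  let e : ℕ := ∑ i ∈ S, (i.val - 1) * ν i
  have he : ∑ i : Fin (r + 2), ((i.val : ℤ) - 1) * (Function.update ν 1 (r - m) i : ℤ) = e := by
    rw [Fin.sum_eq_add_sum_sdiff, Function.update_of_ne (by simp), hν0]
    simp only [e, Nat.cast_sum, Fin.val_one, Nat.cast_one, sub_self, zero_mul, Nat.cast_zero,
      mul_zero, zero_add]
    refine sum_congr rfl fun i hi => ?_
    have : 1 ≤ i.val := Nat.one_le_iff_ne_zero.2 fun h => h0 i hi (Fin.ext h)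
    rw [hupd i hi]
    push_cast [this]
    ring
  have hsum : ∑ i ∈ S, Function.update ν 1 (r - m) i = m := by
    exact (sum_congr rfl hupd).trans hν
  have hsum' : ∑ i ∈ S, (Function.update ν 1 (r - m) i : ℤ) = m := by
    exact_mod_cast hsum
  have hprod : ∏ i ∈ S, (c i ^ Function.update ν 1 (r - m) i /
      ((Function.update ν 1 (r - m) i).factorial : ℂ)) =
      (∏ i ∈ S, c i ^ ν i) / ∏ i ∈ S, ((ν i).factorial : ℂ) := by
    rw [← prod_div_distrib]
    exact prod_congr rfl fun i hi => by rw [hupd i hi]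
  have hzpow : c 1 ^ (-((r : ℤ) + 1 + m)) = (c 1 ^ (r + 1 + m))⁻¹ := by
    rw [zpow_neg]
    norm_cast
  have hsign : (-1 : ℂ) ^ (r - m) = (-1) ^ r * (-1) ^ m := by
    obtain ⟨k, hk⟩ := Nat.exists_eq_add_of_le hmr
    rw [hk, Nat.add_sub_cancel_left, pow_add, mul_right_comm, ← mul_pow]
    simp
  have hfact : ((r + m).factorial : ℂ) = (r + m).choose r * r.factorial *
      ((∏ i ∈ S, ((ν i).factorial : ℂ)) * Nat.multinomial S ν) := by
    have := Nat.multinomial_spec S ν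
    rw [hν] at this
    rw [← Nat.add_choose_mul_factorial_mul_factorial r m, ← this, Nat.choose_symm_add]
    push_cast
    rfl
  have hprod0 : ∏ i ∈ S, ((ν i).factorial : ℂ) ≠ 0 :=
    prod_ne_zero_iff.2 fun i _ => Nat.cast_ne_zero.2 (Nat.factorial_ne_zero _)
  have hcoeff : α ^ x * gbinom x ((r : ℤ) - e) * α ^ (-((r : ℤ) - e)) = coeff r (A * X ^ e) := by
    rw [coeff_mul_X_pow', gbinom]
    split_ifs with hk hk' hk'
    · obtain ⟨k, hk⟩ := Nat.exists_eq_add_of_le hk'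
      have hre : (r : ℤ) - e = k := by omega
      rw [hre, show r - e = k by omega, hA, Int.toNat_natCast, zpow_neg, zpow_natCast,
        cpow_sub _ _ hα, cpow_natCast]
      ring
    · omega
    · omega
    · simp
  rw [he, hsum, hsum', hprod, Function.update_self, hzpow, hsign, hfact]
  simp only [Nat.sub_self, Nat.factorial_zero, Nat.cast_one, sub_self, sub_zero, div_one]
  rw [← hcoeff]
  field_simp
  ring

/-- The Taylor series of `f` at `α`. -/
noncomputable def taylorPowerSeries (f : ℂ → ℂ) (α : ℂ) : PowerSeries ℂ :=
  PowerSeries.mk fun k => iteratedDeriv k f α / k.factorial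

theorem taylorPowerSeries_congr {f g : ℂ → ℂ} {α : ℂ} (h : f =ᶠ[nhds α] g) :
    taylorPowerSeries f α = taylorPowerSeries g α := by
  ext k
  simp [taylorPowerSeries, h.iteratedDeriv_eq k]

theorem taylorPowerSeries_mul {f g : ℂ → ℂ} {α : ℂ} (hf : AnalyticAt ℂ f α)
    (hg : AnalyticAt ℂ g α) :
    taylorPowerSeries (f * g) α = taylorPowerSeries f α * taylorPowerSeries g α := by
  ext k
  simp only [taylorPowerSeries, PowerSeries.coeff_mk, PowerSeries.coeff_mul]
  rw [iteratedDeriv_mul hf.contDiffAt hg.contDiffAt,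
    Finset.Nat.sum_antidiagonal_eq_sum_range_succ_mk, sum_div]
  refine sum_congr rfl fun i hi => ?_
  rw [Nat.cast_choose ℂ (Nat.lt_succ_iff.1 (Finset.mem_range.1 hi))]
  have := Nat.cast_ne_zero (R := ℂ).2 k.factorial_ne_zero
  field_simp

theorem taylorPowerSeries_pow {f : ℂ → ℂ} {α : ℂ} (hf : AnalyticAt ℂ f α) (k : ℕ) :
    taylorPowerSeries (f ^ (k + 1)) α = taylorPowerSeries f α ^ (k + 1) := by
  induction k with
  | zero => simp
  | succ k ih => rw [pow_succ, taylorPowerSeries_mul (hf.pow _) hf, ih, ← pow_succ]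

theorem taylorPowerSeries_sub_const (α : ℂ) :
    taylorPowerSeries (fun z => z - α) α = PowerSeries.X := by
  ext k
  simp only [taylorPowerSeries, PowerSeries.coeff_mk, PowerSeries.coeff_X]
  rcases k with _ | _ | k
  · simp
  · simp
  · have : deriv (fun z : ℂ => z - α) = fun _ => 1 := by
      funext z
      simp
    rw [iteratedDeriv_succ', this, iteratedDeriv_const]
    simp

theorem coeff_taylorPowerSeries_dslope {g : ℂ → ℂ} {α : ℂ}
    (hh : AnalyticAt ℂ (dslope g α) α) (hgα : g α = 0) (k : ℕ) :
    PowerSeries.coeff k (taylorPowerSeries (dslope g α) α) =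
      iteratedDeriv (k + 1) g α / (k + 1).factorial := by
  have : g = (fun z => z - α) * dslope g α := by
    funext z
    have := sub_smul_dslope g α z
    rw [hgα, sub_zero] at this
    exact this.symm
  rw [← PowerSeries.coeff_succ_X_mul, ← taylorPowerSeries_sub_const α,
    ← taylorPowerSeries_mul (by fun_prop) hh, ← this, taylorPowerSeries, PowerSeries.coeff_mk]

theorem iteratedDeriv_cpow_const (x : ℂ) (k : ℕ) {z : ℂ} (hz : z ∈ slitPlane) :
    iteratedDeriv k (fun z => z ^ x) z = fallFac x k * z ^ (x - k) := by
  induction k generalizing z with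
  | zero => simp [fallFac]
  | succ k ih =>
    rw [iteratedDeriv_succ, Filter.EventuallyEq.deriv_eq
      (Filter.eventually_of_mem (isOpen_slitPlane.mem_nhds hz) fun w hw => ih hw)]
    have : HasDerivAt (fun w => fallFac x k * w ^ (x - k)) _ z :=
      ((hasDerivAt_id z).cpow_const (c := x - k) hz).const_mul (fallFac x k)
    rw [HasDerivAt.deriv this, fallFac, fallFac, prod_range_succ]
    simp only [id, mul_one]
    push_cast
    rw [sub_sub, mul_assoc]

theorem prod_cpow_pow {d : ℕ} {z : ℂ} (hz : z ≠ 0) (γ : Fin d → ℂ) (n : Fin d → ℕ) :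
    ∏ i, (z ^ γ i) ^ n i = z ^ ∑ i, (n i : ℂ) * γ i := by
  simp only [cpow_def_of_ne_zero hz, ← exp_nat_mul, ← exp_sum, mul_sum]
  congr 1
  exact sum_congr rfl fun i _ => by ring

theorem taylor_coefficient_general_base
    {d : ℕ} (hd : 1 ≤ d) (γ : Fin d → ℂ) (α : ℂ) (hα : α ∈ Complex.slitPlane)
    (g : ℂ → ℂ) (hg : AnalyticAt ℂ g α) (hgα : g α = 0) (hg' : deriv g α ≠ 0)
    (U : Set (Fin d → ℂ)) (hU : IsOpen U) (h0U : (0 : Fin d → ℂ) ∈ U)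
    (φ : (Fin d → ℂ) → ℂ) (hφ : ContDiffOn ℂ (⊤ : ℕ∞) φ U)
    (hφ0 : φ 0 = α) (hφslit : ∀ a ∈ U, φ a ∈ Complex.slitPlane)
    (hzero : ∀ a ∈ U, g (φ a) + ∑ i, a i * φ a ^ γ i = 0)
    (n : Fin d → ℕ) (hn : 1 ≤ ∑ i, n i) :
    mixedPartial n φ 0 =
      FF α (fun k => iteratedDeriv k g α / (Nat.factorial k : ℂ))
        (∑ i, (n i : ℂ) * γ i) ((∑ i, n i) - 1) 1 := by
  obtain ⟨r, hr⟩ : ∃ r, ∑ i, n i = r + 1 := ⟨_, (Nat.sub_add_cancel hn).symm⟩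
  have hα0 : α ≠ 0 := slitPlane_ne_zero hα
  have hU0 := hU.mem_nhds h0U
  have hG : ∀ i, AnalyticAt ℂ (fun z => z ^ γ i) α := fun i => analyticAt_id.cpow analyticAt_const hα
  have hh : AnalyticAt ℂ (dslope g α) α := by
    obtain ⟨p, hp⟩ := hg
    exact hp.has_fpower_series_dslope_fslope.analyticAt
  have hhα : dslope g α α ≠ 0 := by rwa [dslope_same]
  rw [mixedPartial_implicit hg hgα hg' hG
    (Filter.eventually_of_mem hU0 fun a ha =>
      (hφ.contDiffAt (hU.mem_nhds ha)).differentiableAt (by simp))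
    hφ0 (Filter.eventually_of_mem hU0 hzero) n hr, hr, Nat.add_sub_cancel]
  have hF : AnalyticAt ℂ (fun z => (∏ i, (z ^ γ i) ^ n i) / dslope g α z ^ (r + 1)) α :=
    (Finset.analyticAt_fun_prod _ fun i _ => (hG i).pow (n i)).div (hh.pow _) (pow_ne_zero _ hhα)
  have hFH : taylorPowerSeries (fun z => (∏ i, (z ^ γ i) ^ n i) / dslope g α z ^ (r + 1)) α *
      taylorPowerSeries (dslope g α) α ^ (r + 1) =
      taylorPowerSeries (fun z => z ^ ∑ i, (n i : ℂ) * γ i) α := by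
    rw [← taylorPowerSeries_pow hh, ← taylorPowerSeries_mul hF (hh.pow _)]
    refine taylorPowerSeries_congr ?_
    filter_upwards [isOpen_slitPlane.mem_nhds hα, hh.continuousAt.eventually_ne hhα] with z hz hhz
    rw [Pi.mul_apply, Pi.pow_apply, div_mul_cancel₀ _ (pow_ne_zero _ hhz)]
    exact prod_cpow_pow (slitPlane_ne_zero hz) γ n
  rw [FF_eq_coeff hα0 (fun k => ?_) (coeff_taylorPowerSeries_dslope hh hgα)
    (by simpa using hg') hFH]
  · rw [taylorPowerSeries, PowerSeries.coeff_mk, mul_assoc, mul_div_cancel₀]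
    exact Nat.cast_ne_zero.2 r.factorial_ne_zero
  · rw [taylorPowerSeries, PowerSeries.coeff_mk, iteratedDeriv_cpow_const _ k hα]
end

section
/- For all integers 1 ≤ a ≤ M and all complex numbers x₁,…,x_M, the following identity holds: Σ_{P ∈ S(M,a)} ∏_{B ∈ P} F(Σ_{m∈B} x_m, |B|−1, 1) = F(Σ_{i=1}^M x_i, M−1, a). -/
open Finset Complex

/-- Unordered partitions of the finite set `H` into `k` non-empty pairwise
disjoint blocks. -/
def setPartitions {β : Type*} [DecidableEq β] (H : Finset β) (k : ℕ) :
    Finset (Finset (Finset β)) :=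
  H.powerset.powerset.filter fun P =>
    P.card = k ∧ (∀ B ∈ P, B.Nonempty) ∧
      (∀ B ∈ P, ∀ B' ∈ P, B ≠ B' → Disjoint B B') ∧ P.sup id = H

open PowerSeries in
/-- Leibniz rule for finite products of power series. -/
theorem derivative_prod_powerSeries {ι : Type*} [DecidableEq ι] (S : Finset ι)
    (ψ : ι → PowerSeries ℂ) :
    derivative ℂ (∏ m ∈ S, ψ m) = ∑ m ∈ S, derivative ℂ (ψ m) * ∏ i ∈ S.erase m, ψ i := by
  induction S using Finset.induction_on with
  | empty => simp
  | insert e S he ih =>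
    rw [Finset.prod_insert he, Derivation.leibniz, ih, Finset.sum_insert he,
      Finset.erase_insert he, smul_eq_mul, smul_eq_mul, Finset.mul_sum, add_comm, mul_comm]
    congr 1
    refine Finset.sum_congr rfl fun m hm => ?_
    have hem : e ≠ m := fun h => he (h ▸ hm)
    rw [Finset.erase_insert_of_ne hem, Finset.prod_insert (fun h => he (Finset.mem_of_mem_erase h))]
    ring

/-- The polarised form of the coefficient `n! [yⁿ] k ψⁿ` in Lagrange inversion. -/
noncomputable def lagrangeTheta {ι : Type*} (ψ : ι → PowerSeries ℂ) (k : PowerSeries ℂ)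
    (S : Finset ι) : ℂ :=
  (Nat.factorial #S : ℂ) * PowerSeries.coeff #S (k * ∏ m ∈ S, ψ m)

open Classical in
/-- The polarised form of the coefficient `(n-1)! [yⁿ⁻¹] h' ψⁿ` in Lagrange inversion. -/
noncomputable def lagrangeLambda {ι : Type*} (ψ : ι → PowerSeries ℂ) (h : PowerSeries ℂ)
    (S : Finset ι) : ℂ :=
  if S = ∅ then PowerSeries.constantCoeff h
  else (Nat.factorial (#S - 1) : ℂ) *
    PowerSeries.coeff (#S - 1) (PowerSeries.derivative ℂ h * ∏ m ∈ S, ψ m)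

theorem lagrangeTheta_add {ι : Type*} (ψ : ι → PowerSeries ℂ) (k l : PowerSeries ℂ) (S : Finset ι) :
    lagrangeTheta ψ (k + l) S = lagrangeTheta ψ k S + lagrangeTheta ψ l S := by
  simp only [lagrangeTheta, add_mul, map_add, mul_add]

section Lagrange

variable {ι : Type*} [DecidableEq ι] (ψ : ι → PowerSeries ℂ)

theorem lagrangeLambda_insert (h : PowerSeries ℂ) {e : ι} {S : Finset ι} (he : e ∉ S) :
    lagrangeLambda ψ h (insert e S) =
      lagrangeTheta ψ (PowerSeries.derivative ℂ h * ψ e) S := by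
  rw [lagrangeLambda, if_neg (Finset.insert_ne_empty _ _), lagrangeTheta,
    Finset.card_insert_of_notMem he, Nat.add_sub_cancel, Finset.prod_insert he, mul_assoc]

theorem lagrangeTheta_eq (k : PowerSeries ℂ) (S : Finset ι) :
    lagrangeTheta ψ k S = lagrangeLambda ψ k S +
      ∑ m ∈ S, lagrangeTheta ψ (k * PowerSeries.derivative ℂ (ψ m)) (S.erase m) := by
  rcases S.eq_empty_or_nonempty with rfl | hS
  · simp [lagrangeTheta, lagrangeLambda]
  obtain ⟨n, hn⟩ : ∃ n, #S = n + 1 := ⟨#S - 1, by have := hS.card_pos; omega⟩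
  have h1 : lagrangeTheta ψ k S =
      (Nat.factorial n : ℂ) * PowerSeries.coeff n
        (PowerSeries.derivative ℂ (k * ∏ m ∈ S, ψ m)) := by
    rw [lagrangeTheta, hn, PowerSeries.coeff_derivative, Nat.factorial_succ]
    push_cast
    ring
  rw [h1, Derivation.leibniz, derivative_prod_powerSeries, lagrangeLambda, if_neg hS.ne_empty, hn,
    Nat.add_sub_cancel, map_add, mul_add, smul_eq_mul, smul_eq_mul, Finset.mul_sum, map_sum,
    Finset.mul_sum, add_comm, mul_comm (∏ m ∈ S, ψ m)]
  congr 1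
  refine Finset.sum_congr rfl fun m hm => ?_
  rw [lagrangeTheta, Finset.card_erase_of_mem hm, hn, Nat.add_sub_cancel, mul_assoc k]

theorem sum_powerset_sdiff_comm (S : Finset ι) (f : Finset ι → Finset ι → ℂ) :
    ∑ C ∈ S.powerset, f C (S \ C) = ∑ C ∈ S.powerset, f (S \ C) C := by
  refine Finset.sum_nbij' (fun C => S \ C) (fun C => S \ C) ?_ ?_ ?_ ?_ ?_
  · intro C _; simp
  · intro C _; simp
  · intro C hC; simpa using hC
  · intro C hC; simpa using hC
  · intro C hC; rw [Finset.sdiff_sdiff_eq_self (Finset.mem_powerset.1 hC)]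

/-- Polarised Lagrange inversion: `Θ_{kh}` is the convolution of `Θ_k` and `Λ_h`. -/
theorem lagrangeTheta_mul (k h : PowerSeries ℂ) (S : Finset ι) :
    lagrangeTheta ψ (k * h) S =
      ∑ C ∈ S.powerset, lagrangeTheta ψ k (S \ C) * lagrangeLambda ψ h C := by
  induction S using Finset.strongInduction generalizing k h with
  | H S ih =>
  have hlam : lagrangeLambda ψ (k * h) S =
      ∑ C ∈ S.powerset, lagrangeLambda ψ k (S \ C) * lagrangeLambda ψ h C := by
    rcases S.eq_empty_or_nonempty with rfl | ⟨e, he⟩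
    · simp [lagrangeLambda]
    obtain ⟨S', heS', rfl⟩ : ∃ S', e ∉ S' ∧ S = insert e S' :=
      ⟨S.erase e, Finset.notMem_erase e S, (Finset.insert_erase he).symm⟩
    have ih' := ih S' (Finset.ssubset_insert heS')
    rw [lagrangeLambda_insert ψ _ heS', Derivation.leibniz, smul_eq_mul, smul_eq_mul,
      show (k * PowerSeries.derivative ℂ h + h * PowerSeries.derivative ℂ k) * ψ e =
        (PowerSeries.derivative ℂ k * ψ e) * h + (PowerSeries.derivative ℂ h * ψ e) * k by ring,
      lagrangeTheta_add, ih', ih', Finset.sum_powerset_insert heS']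
    congr 1
    · refine Finset.sum_congr rfl fun C hC => ?_
      have heC : e ∉ C := fun h => heS' (Finset.mem_powerset.1 hC h)
      rw [Finset.insert_sdiff_of_notMem _ heC, lagrangeLambda_insert]
      simp [heS']
    · rw [← sum_powerset_sdiff_comm S'
        (fun A B => lagrangeTheta ψ (PowerSeries.derivative ℂ h * ψ e) A * lagrangeLambda ψ k B)]
      refine Finset.sum_congr rfl fun C hC => ?_
      have heC : e ∉ C := fun h => heS' (Finset.mem_powerset.1 hC h)
      rw [lagrangeLambda_insert ψ h heC, mul_comm, Finset.insert_sdiff_insert,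
        Finset.sdiff_insert_of_notMem heS']
  have hswap : ∑ C ∈ S.powerset, ∑ m ∈ S \ C,
        lagrangeTheta ψ (k * PowerSeries.derivative ℂ (ψ m)) ((S \ C).erase m) *
          lagrangeLambda ψ h C =
      ∑ m ∈ S, ∑ C ∈ (S.erase m).powerset,
        lagrangeTheta ψ (k * PowerSeries.derivative ℂ (ψ m)) ((S.erase m) \ C) *
          lagrangeLambda ψ h C := by
    rw [Finset.sum_comm' (t' := S) (s' := fun m => (S.erase m).powerset)]
    · refine Finset.sum_congr rfl fun m _ => Finset.sum_congr rfl fun C _ => ?_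
      rw [Finset.erase_sdiff_comm]
    · intro C m
      simp only [Finset.mem_powerset, Finset.mem_sdiff, Finset.subset_erase]
      tauto
  rw [lagrangeTheta_eq, hlam]
  simp_rw [lagrangeTheta_eq ψ k, add_mul, Finset.sum_add_distrib, Finset.sum_mul]
  rw [hswap]
  congr 1
  refine Finset.sum_congr rfl fun m hm => ?_
  rw [← ih _ (Finset.erase_ssubset hm), mul_right_comm]

end Lagrange

theorem mem_setPartitions {β : Type*} [DecidableEq β] {H : Finset β} {k : ℕ}
    {P : Finset (Finset β)} :
    P ∈ setPartitions H k ↔ P.card = k ∧ (∀ B ∈ P, B.Nonempty) ∧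
      (∀ B ∈ P, ∀ B' ∈ P, B ≠ B' → Disjoint B B') ∧ P.sup id = H := by
  rw [setPartitions, Finset.mem_filter, and_iff_right_iff_imp]
  rintro ⟨-, -, -, rfl⟩
  rw [Finset.mem_powerset]
  intro B hB
  exact Finset.mem_powerset.2 (Finset.le_sup (f := id) hB)

/-- Splitting off the block that contains a given element. -/
theorem sum_setPartitions_insert {β : Type*} [DecidableEq β] {e : β} {S : Finset β} (he : e ∉ S)
    (a : ℕ) (T : Finset β → ℂ) :
    ∑ P ∈ setPartitions (insert e S) (a + 1), ∏ B ∈ P, T B =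
      ∑ C ∈ S.powerset, T (insert e (S \ C)) * ∑ Q ∈ setPartitions C a, ∏ B ∈ Q, T B := by
  simp_rw [Finset.mul_sum]
  rw [Finset.sum_sigma']
  symm
  have key : ∀ C ⊆ S, ∀ Q ∈ setPartitions C a, ∀ B ∈ Q, B ⊆ C := by
    intro C _ Q hQ B hB
    rw [← (mem_setPartitions.1 hQ).2.2.2]
    exact Finset.le_sup (f := id) hB
  have key2 : ∀ C ⊆ S, ∀ Q ∈ setPartitions C a, insert e (S \ C) ∉ Q := by
    intro C hC Q hQ h
    exact he (hC (key C hC Q hQ _ h (Finset.mem_insert_self _ _)))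
  refine Finset.sum_bij (fun x _ => insert (insert e (S \ x.1)) x.2) ?_ ?_ ?_ ?_
  · rintro ⟨C, Q⟩ hx
    simp only [Finset.mem_sigma, Finset.mem_powerset] at hx
    obtain ⟨hC, hQ⟩ := hx
    have hd : ∀ B ∈ Q, Disjoint (insert e (S \ C)) B := by
      intro B hB
      have hBC := key C hC Q hQ B hB
      rw [Finset.disjoint_insert_left]
      exact ⟨fun h => he (hC (hBC h)), Finset.disjoint_of_subset_right hBC Finset.sdiff_disjoint⟩
    have hk2 := key2 C hC Q hQ
    obtain ⟨h1, h2, h3, h4⟩ := mem_setPartitions.1 hQ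
    rw [mem_setPartitions]
    refine ⟨by rw [Finset.card_insert_of_notMem hk2, h1], ?_, ?_, ?_⟩
    · intro B hB
      rcases Finset.mem_insert.1 hB with rfl | hB
      · exact Finset.insert_nonempty _ _
      · exact h2 B hB
    · intro B hB B' hB' hne
      rcases Finset.mem_insert.1 hB with rfl | hB <;> rcases Finset.mem_insert.1 hB' with rfl | hB'
      · exact absurd rfl hne
      · exact hd _ hB'
      · exact (hd _ hB).symm
      · exact h3 B hB B' hB' hne
    · rw [Finset.sup_insert, h4, id, Finset.sup_eq_union, Finset.insert_union,
        Finset.sdiff_union_of_subset hC]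
  · rintro ⟨C, Q⟩ hx ⟨C', Q'⟩ hx' heq
    simp only [Finset.mem_sigma, Finset.mem_powerset] at hx hx' heq
    obtain ⟨hC, hQ⟩ := hx
    obtain ⟨hC', hQ'⟩ := hx'
    have hblock : insert e (S \ C) = insert e (S \ C') := by
      have hmem : insert e (S \ C) ∈ insert (insert e (S \ C')) Q' :=
        heq ▸ Finset.mem_insert_self _ _
      rcases Finset.mem_insert.1 hmem with h | h
      · exact h
      · exact absurd (hC' (key C' hC' Q' hQ' _ h (Finset.mem_insert_self _ _))) he
    have hQQ : Q = Q' := by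
      rw [← Finset.erase_insert (key2 C hC Q hQ), ← Finset.erase_insert (key2 C' hC' Q' hQ'), heq,
        hblock]
    have hCC : C = C' := by
      rw [← (mem_setPartitions.1 hQ).2.2.2, ← (mem_setPartitions.1 hQ').2.2.2, hQQ]
    subst hQQ hCC
    rfl
  · intro P hP
    obtain ⟨h1, h2, h3, h4⟩ := mem_setPartitions.1 hP
    obtain ⟨B, hB, heB⟩ : ∃ B ∈ P, e ∈ B := by
      have : e ∈ P.sup id := h4 ▸ Finset.mem_insert_self _ _
      simpa [Finset.mem_sup] using this
    have hBS : B ⊆ insert e S := h4 ▸ Finset.le_sup (f := id) hB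
    have hsup : (P.erase B).sup id = S \ B := by
      ext y
      simp only [Finset.mem_sup, Finset.mem_erase, id, Finset.mem_sdiff]
      have hy : y ∈ insert e S ↔ ∃ A ∈ P, y ∈ A := by rw [← h4]; simp [Finset.mem_sup]
      constructor
      · rintro ⟨A, ⟨hAB, hA⟩, hyA⟩
        have hyB : y ∉ B := Finset.disjoint_left.1 (h3 A hA B hB hAB) hyA
        refine ⟨?_, hyB⟩
        rcases Finset.mem_insert.1 (hy.2 ⟨A, hA, hyA⟩) with rfl | h
        · exact absurd heB hyB
        · exact h
      · rintro ⟨hyS, hyB⟩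
        obtain ⟨A, hA, hyA⟩ := hy.1 (Finset.mem_insert_of_mem hyS)
        exact ⟨A, ⟨fun h => hyB (h ▸ hyA), hA⟩, hyA⟩
    have hBeq : insert e (S \ (S \ B)) = B := by
      ext y
      have hyS := @hBS y
      simp only [Finset.mem_insert, Finset.mem_sdiff] at hyS ⊢
      constructor
      · rintro (rfl | ⟨h, h'⟩)
        · exact heB
        · by_contra hc
          exact h' ⟨h, hc⟩
      · intro h
        rcases hyS h with h' | h'
        · exact Or.inl h'
        · exact Or.inr ⟨h', fun h'' => h''.2 h⟩
    refine ⟨⟨S \ B, P.erase B⟩, ?_, ?_⟩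
    · simp only [Finset.mem_sigma, Finset.mem_powerset]
      refine ⟨Finset.sdiff_subset, mem_setPartitions.2 ⟨?_, ?_, ?_, hsup⟩⟩
      · rw [Finset.card_erase_of_mem hB, h1, Nat.add_sub_cancel]
      · exact fun A hA => h2 A (Finset.mem_of_mem_erase hA)
      · exact fun A hA A' hA' =>
          h3 A (Finset.mem_of_mem_erase hA) A' (Finset.mem_of_mem_erase hA')
    · rw [hBeq, Finset.insert_erase hB]
  · rintro ⟨C, Q⟩ hx
    simp only [Finset.mem_sigma, Finset.mem_powerset] at hx
    rw [Finset.prod_insert (key2 C hx.1 Q hx.2)]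

/-- The sum over set partitions of the polarised Lagrange coefficients. -/
theorem factorial_mul_sum_setPartitions {ι : Type*} [DecidableEq ι] (ψ : ι → PowerSeries ℂ)
    (a : ℕ) (S : Finset ι) :
    (Nat.factorial a : ℂ) * ∑ P ∈ setPartitions S a, ∏ B ∈ P,
        ((Nat.factorial (#B - 1) : ℂ) * PowerSeries.coeff (#B - 1) (∏ m ∈ B, ψ m)) =
      lagrangeLambda ψ (PowerSeries.X ^ a) S := by
  induction a generalizing S with
  | zero =>
    rcases S.eq_empty_or_nonempty with rfl | hS
    · have : setPartitions (∅ : Finset ι) 0 = {∅} := by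
        ext P
        rw [mem_setPartitions, Finset.mem_singleton, Finset.card_eq_zero]
        constructor
        · exact fun h => h.1
        · rintro rfl
          simp
      simp [this, lagrangeLambda]
    · have : setPartitions S 0 = ∅ := by
        ext P
        rw [mem_setPartitions, Finset.card_eq_zero]
        simp only [Finset.notMem_empty, iff_false]
        rintro ⟨rfl, -, -, h⟩
        exact hS.ne_empty (by simpa using h.symm)
      simp [this, lagrangeLambda, hS.ne_empty]
  | succ a ih =>
    rcases S.eq_empty_or_nonempty with rfl | ⟨e, he⟩
    · have : setPartitions (∅ : Finset ι) (a + 1) = ∅ := by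
        ext P
        rw [mem_setPartitions]
        simp only [Finset.notMem_empty, iff_false]
        rintro ⟨h1, h2, -, h⟩
        obtain ⟨B, hB⟩ := Finset.card_pos.1 (by omega : 0 < #P)
        have hBe : B ≤ ∅ := h ▸ Finset.le_sup (f := id) hB
        exact (h2 B hB).ne_empty (Finset.subset_empty.1 hBe)
      simp [this, lagrangeLambda]
    obtain ⟨S', heS', rfl⟩ : ∃ S', e ∉ S' ∧ S = insert e S' :=
      ⟨S.erase e, Finset.notMem_erase e S, (Finset.insert_erase he).symm⟩
    have hd : PowerSeries.derivative ℂ ((PowerSeries.X : PowerSeries ℂ) ^ (a + 1)) * ψ e =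
        PowerSeries.C ((a : ℂ) + 1) * ψ e * PowerSeries.X ^ a := by
      rw [PowerSeries.derivative_pow, PowerSeries.derivative_X]
      simp
      ring
    rw [sum_setPartitions_insert heS', lagrangeLambda_insert ψ _ heS', hd, lagrangeTheta_mul,
      Finset.mul_sum]
    refine Finset.sum_congr rfl fun C hC => ?_
    have heC : e ∉ S' \ C := fun h => heS' (Finset.mem_sdiff.1 h).1
    rw [← ih, lagrangeTheta, Finset.card_insert_of_notMem heC, Nat.add_sub_cancel,
      Finset.prod_insert heC, Nat.factorial_succ, mul_assoc (PowerSeries.C _),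
      PowerSeries.coeff_C_mul]
    push_cast
    ring

theorem sum_setPartitions_coeff {ι : Type*} [DecidableEq ι] (ψ : ι → PowerSeries ℂ)
    {a : ℕ} {S : Finset ι} (ha : 1 ≤ a) (haS : a ≤ #S) :
    ∑ P ∈ setPartitions S a, ∏ B ∈ P,
        ((Nat.factorial (#B - 1) : ℂ) * PowerSeries.coeff (#B - 1) (∏ m ∈ B, ψ m)) =
      (Nat.factorial (#S - 1) : ℂ) / (Nat.factorial (a - 1) : ℂ) *
        PowerSeries.coeff (#S - a) (∏ m ∈ S, ψ m) := by
  have h := factorial_mul_sum_setPartitions ψ a S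
  obtain ⟨b, rfl⟩ : ∃ b, a = b + 1 := ⟨a - 1, by omega⟩
  have hS : S ≠ ∅ := by rintro rfl; simp at haS
  have hd : PowerSeries.derivative ℂ ((PowerSeries.X : PowerSeries ℂ) ^ (b + 1)) =
      PowerSeries.C ((b : ℂ) + 1) * PowerSeries.X ^ b := by
    rw [PowerSeries.derivative_pow, PowerSeries.derivative_X]
    simp
  rw [lagrangeLambda, if_neg hS, hd, mul_assoc, PowerSeries.coeff_C_mul,
    PowerSeries.coeff_X_pow_mul', if_pos (by omega), Nat.factorial_succ,
    show #S - 1 - b = #S - (b + 1) by omega] at h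
  have hb : ((b : ℂ) + 1) ≠ 0 := by exact_mod_cast Nat.succ_ne_zero b
  have hf : (Nat.factorial b : ℂ) ≠ 0 := by exact_mod_cast Nat.factorial_ne_zero b
  rw [Nat.add_sub_cancel, div_mul_eq_mul_div, eq_div_iff hf]
  apply mul_left_cancel₀ hb
  push_cast at h
  linear_combination h

theorem gbinom_natCast (x : ℂ) (j : ℕ) : gbinom x (j : ℤ) = Ring.choose x j := by
  have hp : ∀ k, fallFac x k = (descPochhammer ℂ k).eval x := by
    intro k
    rw [fallFac, descPochhammer_eval_eq_prod_range]
  have h := Ring.descPochhammer_eq_factorial_smul_choose x j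
  rw [gbinom, if_pos (Int.natCast_nonneg j), Int.toNat_natCast, hp,
    div_eq_iff (by exact_mod_cast Nat.factorial_ne_zero j)]
  rw [← Polynomial.aeval_eq_smeval, Polynomial.aeval_def, Polynomial.eval₂_eq_eval_map,
    descPochhammer_map, nsmul_eq_mul] at h
  rw [h, mul_comm]

/-- The expansion of `(α + X) ^ x`. -/
noncomputable def powSeries (α x : ℂ) : PowerSeries ℂ :=
  PowerSeries.C (α ^ x) * PowerSeries.rescale α⁻¹ (PowerSeries.binomialSeries ℂ x)

theorem coeff_powSeries (α x : ℂ) (j : ℕ) :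
    PowerSeries.coeff j (powSeries α x) = α ^ x * (gbinom x (j : ℤ) * α ^ (-(j : ℤ))) := by
  rw [powSeries, PowerSeries.coeff_C_mul, PowerSeries.coeff_rescale,
    PowerSeries.binomialSeries_coeff, gbinom_natCast, zpow_neg, zpow_natCast, inv_pow, smul_eq_mul,
    mul_one, mul_comm (Ring.choose x j)]

theorem prod_powSeries {ι : Type*} {α : ℂ} (hα : α ≠ 0) (x : ι → ℂ) (S : Finset ι) :
    ∏ m ∈ S, powSeries α (x m) = powSeries α (∑ m ∈ S, x m) := by
  classical
  induction S using Finset.induction_on with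
  | empty => simp [powSeries]
  | insert e S he ih =>
    rw [Finset.prod_insert he, Finset.sum_insert he, ih]
    simp only [powSeries, Complex.cpow_add _ _ hα, PowerSeries.binomialSeries_add, map_mul]
    ring

/-- The truncated expansion of `(1 - t) ^ (-(r + 1))`. -/
theorem pow_dvd_sum_choose_mul_sub_one {R : Type*} [CommRing R] (t : R) (r n : ℕ) :
    t ^ n ∣ (∑ k ∈ Finset.range n, ((r + k).choose r : R) * t ^ k) * (1 - t) ^ (r + 1) - 1 := by
  have hstep : ∀ r n : ℕ,
      (∑ k ∈ Finset.range n, ((r + 1 + k).choose (r + 1) : R) * t ^ k) * (1 - t) =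
        (∑ k ∈ Finset.range n, ((r + k).choose r : R) * t ^ k) -
          ((r + n).choose (r + 1) : R) * t ^ n := by
    intro r n
    induction n with
    | zero => simp
    | succ n ih =>
      have hpascal : ((r + 1 + n).choose (r + 1) : R) =
          (r + n).choose r + (r + n).choose (r + 1) := by
        rw [show r + 1 + n = r + n + 1 by ring, Nat.choose_succ_succ]
        push_cast
        rfl
      rw [Finset.sum_range_succ, Finset.sum_range_succ, add_mul, ih,
        show r + (n + 1) = r + 1 + n by ring, pow_succ]
      linear_combination t ^ n * hpascal
  induction r with
  | zero =>
    refine ⟨-1, ?_⟩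
    have h := geom_sum_mul_neg t n
    simp only [zero_add, Nat.choose_zero_right, Nat.cast_one, one_mul, pow_one]
    linear_combination h
  | succ r ih =>
    obtain ⟨q, hq⟩ := ih
    refine ⟨q - ((r + n).choose (r + 1) : R) * (1 - t) ^ (r + 1), ?_⟩
    linear_combination hq + (1 - t) ^ (r + 1) * hstep r n

theorem sum_fin_eq_add_sum_sdiff {N : Type*} [AddCommMonoid N] {r : ℕ} (f : Fin (r + 2) → N) :
    ∑ i, f i = f 0 + f 1 + ∑ i ∈ Finset.univ \ ({0, 1} : Finset (Fin (r + 2))), f i := by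
  rw [← Finset.sum_sdiff (Finset.subset_univ ({0, 1} : Finset (Fin (r + 2)))),
    Finset.sum_pair (by simp), add_comm]

/-- A sum over `comps r` of a function that ignores `μ 0` and `μ 1`. -/
theorem sum_comps_s1 {N : Type*} [AddCommMonoid N] {r : ℕ} (g : (Fin (r + 2) → ℕ) → N)
    (hg : ∀ μ ν : Fin (r + 2) → ℕ,
      (∀ i ∈ Finset.univ \ ({0, 1} : Finset (Fin (r + 2))), μ i = ν i) → g μ = g ν) :
    ∑ μ ∈ comps r, g μ = ∑ k ∈ Finset.range (r + 1),
      ∑ ν ∈ Finset.piAntidiag (Finset.univ \ ({0, 1} : Finset (Fin (r + 2)))) k, g ν := by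
  set T := Finset.univ \ ({0, 1} : Finset (Fin (r + 2))) with hT
  have hmemT : ∀ i : Fin (r + 2), i ∈ T ↔ i ≠ 0 ∧ i ≠ 1 := by
    intro i
    simp [hT]
  have h01 : (0 : Fin (r + 2)) ≠ 1 := by simp
  rw [Finset.sum_sigma']
  refine Finset.sum_bij' (fun μ _ => ⟨∑ i ∈ T, μ i, fun i => if i ∈ T then μ i else 0⟩)
    (fun x _ => Function.update x.2 1 (r - x.1)) ?_ ?_ ?_ ?_ ?_
  · intro μ hμ
    simp only [comps, Finset.mem_filter] at hμ
    have hs := hμ.2.2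
    rw [sum_fin_eq_add_sum_sdiff, ← hT] at hs
    simp only [Finset.mem_sigma, Finset.mem_range, Finset.mem_piAntidiag]
    refine ⟨by omega, Finset.sum_congr rfl fun i hi => if_pos hi, ?_⟩
    intro i hi
    by_contra hc
    exact hi (if_neg hc)
  · rintro ⟨k, ν⟩ hx
    simp only [Finset.mem_sigma, Finset.mem_range, Finset.mem_piAntidiag] at hx
    obtain ⟨hk, hsum, hsupp⟩ := hx
    have h0 : ν 0 = 0 := by
      by_contra hc
      exact ((hmemT 0).1 (hsupp 0 hc)).1 rfl
    have hcongr : ∑ i ∈ T, Function.update ν 1 (r - k) i = ∑ i ∈ T, ν i :=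
      Finset.sum_congr rfl fun i hi => Function.update_of_ne ((hmemT i).1 hi).2 _ _
    have htot : ∑ i, Function.update ν 1 (r - k) i = r := by
      rw [sum_fin_eq_add_sum_sdiff, ← hT, hcongr, hsum, Function.update_self,
        Function.update_of_ne h01, h0]
      omega
    simp only [comps, Finset.mem_filter, Fintype.mem_piFinset, Finset.mem_range]
    refine ⟨fun i => ?_, by rw [Function.update_of_ne h01, h0], htot⟩
    have := Finset.single_le_sum (f := Function.update ν 1 (r - k)) (fun _ _ => Nat.zero_le _)
      (Finset.mem_univ i)
    omega
  · intro μ hμ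
    simp only [comps, Finset.mem_filter] at hμ
    have hs := hμ.2.2
    rw [sum_fin_eq_add_sum_sdiff, ← hT] at hs
    funext i
    by_cases hi : i = 1
    · subst hi
      have h0 := hμ.2.1
      rw [Function.update_self]
      change r - ∑ i ∈ T, μ i = μ 1
      omega
    · rw [Function.update_of_ne hi]
      by_cases hi0 : i = 0
      · subst hi0
        simp [hμ.2.1]
      · exact if_pos ((hmemT i).2 ⟨hi0, hi⟩)
  · rintro ⟨k, ν⟩ hx
    simp only [Finset.mem_sigma, Finset.mem_range, Finset.mem_piAntidiag] at hx
    obtain ⟨hk, hsum, hsupp⟩ := hx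
    have hcongr : ∑ i ∈ T, Function.update ν 1 (r - k) i = ∑ i ∈ T, ν i :=
      Finset.sum_congr rfl fun i hi => Function.update_of_ne ((hmemT i).1 hi).2 _ _
    simp only [Sigma.mk.injEq, hcongr, hsum, heq_eq_eq, true_and]
    funext i
    split_ifs with hi
    · exact Function.update_of_ne ((hmemT i).1 hi).2 _ _
    · by_contra hc
      exact hi (hsupp i (Ne.symm hc))
  · intro μ _
    exact hg _ _ fun i hi => (if_pos hi).symm

/-- The inverse of the series `c₁ + c₂ X + c₃ X² + ⋯`. -/
noncomputable def invSeries (c : ℕ → ℂ) : PowerSeries ℂ :=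
  (PowerSeries.mk fun i => c (i + 1))⁻¹

/-- The coefficient attached to `μ` in the expansion of `r! (c₁ + c₂ X + ⋯) ^ (-(r + 1))`. -/
noncomputable def compsWeight (c : ℕ → ℂ) {r : ℕ} (μ : Fin (r + 2) → ℕ) : ℂ :=
  (-1) ^ (∑ i ∈ Finset.univ \ ({0, 1} : Finset (Fin (r + 2))), μ i) *
    (Nat.factorial (r + ∑ i ∈ Finset.univ \ ({0, 1} : Finset (Fin (r + 2))), μ i) : ℂ) *
    (c 1)⁻¹ ^ (r + 1 + ∑ i ∈ Finset.univ \ ({0, 1} : Finset (Fin (r + 2))), μ i) *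
    ∏ i ∈ Finset.univ \ ({0, 1} : Finset (Fin (r + 2))), (c i ^ μ i / (Nat.factorial (μ i) : ℂ))

/-- The exponent `∑ (i - 1) μ i` over `i ≥ 2`. -/
def compsDegree {r : ℕ} (μ : Fin (r + 2) → ℕ) : ℕ :=
  ∑ i ∈ Finset.univ \ ({0, 1} : Finset (Fin (r + 2))), (i.val - 1) * μ i

theorem sum_compsWeight_eq (c : ℕ → ℂ) (r : ℕ) :
    ∑ μ ∈ comps r, PowerSeries.C (compsWeight c μ) * PowerSeries.X ^ compsDegree μ =
      PowerSeries.C ((Nat.factorial r : ℂ) * (c 1)⁻¹ ^ (r + 1)) *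
        ∑ k ∈ Finset.range (r + 1), ((r + k).choose r : PowerSeries ℂ) *
          (-(PowerSeries.C (c 1)⁻¹ * ∑ i ∈ Finset.univ \ ({0, 1} : Finset (Fin (r + 2))),
            PowerSeries.C (c i) * PowerSeries.X ^ (i.val - 1))) ^ k := by
  rw [sum_comps_s1]
  · rw [Finset.mul_sum]
    refine Finset.sum_congr rfl fun k _ => ?_
    rw [neg_pow, mul_pow, Finset.sum_pow_eq_sum_piAntidiag]
    simp_rw [Finset.mul_sum]
    refine Finset.sum_congr rfl fun ν hν => ?_
    have hk := (Finset.mem_piAntidiag.1 hν).1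
    have hprod : ∏ i ∈ Finset.univ \ ({0, 1} : Finset (Fin (r + 2))),
        (PowerSeries.C (c i) * (PowerSeries.X : PowerSeries ℂ) ^ (i.val - 1)) ^ ν i =
        PowerSeries.C (∏ i ∈ Finset.univ \ ({0, 1} : Finset (Fin (r + 2))), c i ^ ν i) *
          PowerSeries.X ^ compsDegree ν := by
      simp_rw [mul_pow, ← pow_mul]
      rw [Finset.prod_mul_distrib, Finset.prod_pow_eq_pow_sum, map_prod, compsDegree]
      simp_rw [map_pow]
    have hw : compsWeight c ν = (Nat.factorial r : ℂ) * (c 1)⁻¹ ^ (r + 1) *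
        ((r + k).choose r * ((-1) ^ k * (c 1)⁻¹ ^ k *
          ((Nat.multinomial (Finset.univ \ ({0, 1} : Finset (Fin (r + 2)))) ν : ℂ) *
          ∏ i ∈ Finset.univ \ ({0, 1} : Finset (Fin (r + 2))), c i ^ ν i))) := by
      have h1 := Nat.multinomial_spec (Finset.univ \ ({0, 1} : Finset (Fin (r + 2)))) ν
      have h2 := Nat.add_choose_mul_factorial_mul_factorial r k
      rw [hk] at h1
      rw [← h1, ← Nat.choose_symm_add] at h2
      have h3 : ((∏ i ∈ Finset.univ \ ({0, 1} : Finset (Fin (r + 2))),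
          Nat.factorial (ν i) : ℕ) : ℂ) ≠ 0 := by
        exact_mod_cast Finset.prod_ne_zero_iff.2 fun i _ => Nat.factorial_ne_zero _
      rw [compsWeight, hk, Finset.prod_div_distrib, ← h2]
      rw [Nat.cast_prod] at h3
      push_cast
      field_simp
      ring
    rw [hprod, hw]
    simp only [map_mul, map_pow, map_neg, map_one, map_natCast]
    ring
  · intro μ ν h
    have h1 : ∑ i ∈ Finset.univ \ ({0, 1} : Finset (Fin (r + 2))), μ i =
        ∑ i ∈ Finset.univ \ ({0, 1} : Finset (Fin (r + 2))), ν i := Finset.sum_congr rfl h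
    have h2 : compsDegree μ = compsDegree ν :=
      Finset.sum_congr rfl fun i hi => by rw [h i hi]
    have h3 : ∏ i ∈ Finset.univ \ ({0, 1} : Finset (Fin (r + 2))),
        (c i ^ μ i / (Nat.factorial (μ i) : ℂ)) =
        ∏ i ∈ Finset.univ \ ({0, 1} : Finset (Fin (r + 2))),
          (c i ^ ν i / (Nat.factorial (ν i) : ℂ)) :=
      Finset.prod_congr rfl fun i hi => by rw [h i hi]
    rw [compsWeight, compsWeight, h1, h2, h3]

theorem X_pow_dvd_sum_compsWeight_sub {c : ℕ → ℂ} (hc : c 1 ≠ 0) (r : ℕ) :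
    (PowerSeries.X : PowerSeries ℂ) ^ (r + 1) ∣
      ∑ μ ∈ comps r, PowerSeries.C (compsWeight c μ) * PowerSeries.X ^ compsDegree μ -
        PowerSeries.C (Nat.factorial r : ℂ) * invSeries c ^ (r + 1) := by
  rw [sum_compsWeight_eq]
  set V : PowerSeries ℂ := ∑ i ∈ Finset.univ \ ({0, 1} : Finset (Fin (r + 2))),
    PowerSeries.C (c i) * PowerSeries.X ^ (i.val - 1) with hV
  set u : PowerSeries ℂ := PowerSeries.mk fun i => c (i + 1) with hu
  have hmemT : ∀ i : Fin (r + 2), i ∈ Finset.univ \ ({0, 1} : Finset (Fin (r + 2))) ↔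
      2 ≤ i.val := by
    intro i
    simp only [Finset.mem_sdiff, Finset.mem_univ, true_and, Finset.mem_insert,
      Finset.mem_singleton, not_or, Fin.ext_iff, Fin.val_zero, Fin.val_one]
    omega
  have hXV : (PowerSeries.X : PowerSeries ℂ) ∣ V := by
    refine Finset.dvd_sum fun i hi => Dvd.dvd.mul_left (dvd_pow_self _ ?_) _
    have := (hmemT i).1 hi
    omega
  have huV : (PowerSeries.X : PowerSeries ℂ) ^ (r + 1) ∣ u - (PowerSeries.C (c 1) + V) := by
    rw [PowerSeries.X_pow_dvd_iff]
    intro m hm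
    rw [map_sub, map_add, hV, map_sum, hu, PowerSeries.coeff_mk, PowerSeries.coeff_C]
    simp_rw [PowerSeries.coeff_C_mul, PowerSeries.coeff_X_pow]
    rcases Nat.eq_zero_or_pos m with rfl | hm0
    · rw [Finset.sum_eq_zero]
      · simp
      · intro i hi
        have := (hmemT i).1 hi
        rw [if_neg (by omega), mul_zero]
    · rw [if_neg (by omega), Finset.sum_eq_single (⟨m + 1, by omega⟩ : Fin (r + 2))]
      · simp
      · intro i hi hne
        have := (hmemT i).1 hi
        rw [if_neg, mul_zero]
        intro h
        exact hne (Fin.ext (by simp only; omega))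
      · intro h
        exact absurd ((hmemT _).2 (by simp only; omega)) h
  have hinv : u * invSeries c = 1 := by
    rw [invSeries, ← hu]
    refine PowerSeries.mul_inv_cancel _ ?_
    rw [hu, ← PowerSeries.coeff_zero_eq_constantCoeff_apply, PowerSeries.coeff_mk]
    exact hc
  set t : PowerSeries ℂ := -(PowerSeries.C (c 1)⁻¹ * V) with ht
  set σ : PowerSeries ℂ :=
    ∑ k ∈ Finset.range (r + 1), ((r + k).choose r : PowerSeries ℂ) * t ^ k
  have hCC : PowerSeries.C (c 1) * PowerSeries.C (c 1)⁻¹ = (1 : PowerSeries ℂ) := by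
    rw [← map_mul, mul_inv_cancel₀ hc, map_one]
  have hone : PowerSeries.C (c 1) + V = PowerSeries.C (c 1) * (1 - t) := by
    rw [ht]
    linear_combination -V * hCC
  have hXt : (PowerSeries.X : PowerSeries ℂ) ^ (r + 1) ∣ t ^ (r + 1) :=
    pow_dvd_pow_of_dvd ((Dvd.dvd.mul_left hXV _).neg_right) _
  obtain ⟨p, hp⟩ := hXt.trans (pow_dvd_sum_choose_mul_sub_one t r (r + 1))
  obtain ⟨q, hq⟩ := huV.trans (sub_dvd_pow_sub_pow u (PowerSeries.C (c 1) + V) (r + 1))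
  have hCCr : PowerSeries.C (c 1) ^ (r + 1) * PowerSeries.C ((c 1)⁻¹ ^ (r + 1)) =
      (1 : PowerSeries ℂ) := by
    rw [map_pow, ← mul_pow, hCC, one_pow]
  have hinvr : u ^ (r + 1) * invSeries c ^ (r + 1) = 1 := by
    rw [← mul_pow, hinv, one_pow]
  rw [hone, mul_pow] at hq
  rw [map_mul]
  refine ⟨PowerSeries.C (Nat.factorial r : ℂ) * invSeries c ^ (r + 1) *
    (p + PowerSeries.C ((c 1)⁻¹ ^ (r + 1)) * σ * q), ?_⟩
  generalize PowerSeries.C ((c 1)⁻¹ ^ (r + 1)) = d at *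
  generalize PowerSeries.C (c 1) ^ (r + 1) = e at *
  generalize PowerSeries.C (Nat.factorial r : ℂ) = f at *
  generalize invSeries c ^ (r + 1) = w at *
  generalize u ^ (r + 1) = v at *
  linear_combination f * w * hp + f * w * d * σ * hq - f * d * σ * hinvr +
    f * w * σ * (1 - t) ^ (r + 1) * hCCr

theorem FF_eq_coeff_s1 {α : ℂ} {c : ℕ → ℂ} (hc : c 1 ≠ 0) (x : ℂ) {r a : ℕ}
    (ha : 1 ≤ a) (har : a ≤ r + 1) :
    FF α c x r a = (Nat.factorial r : ℂ) / (Nat.factorial (a - 1) : ℂ) *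
      PowerSeries.coeff (r + 1 - a) (powSeries α x * (-invSeries c) ^ (r + 1)) := by
  have hcoeff : (Nat.factorial r : ℂ) *
      PowerSeries.coeff (r + 1 - a) (powSeries α x * invSeries c ^ (r + 1)) =
      ∑ μ ∈ comps r, compsWeight c μ *
        PowerSeries.coeff (r + 1 - a) (powSeries α x * PowerSeries.X ^ compsDegree μ) := by
    have h := PowerSeries.X_pow_dvd_iff.1
      ((X_pow_dvd_sum_compsWeight_sub hc r).mul_left (powSeries α x)) (r + 1 - a) (by omega)
    rw [mul_sub, map_sub, sub_eq_zero, mul_left_comm, PowerSeries.coeff_C_mul] at h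
    rw [← h, Finset.mul_sum, map_sum]
    refine Finset.sum_congr rfl fun μ _ => ?_
    rw [mul_left_comm, PowerSeries.coeff_C_mul]
  have hneg : powSeries α x * (-invSeries c) ^ (r + 1) =
      PowerSeries.C ((-1) ^ (r + 1)) * (powSeries α x * invSeries c ^ (r + 1)) := by
    rw [neg_pow, map_pow, map_neg, map_one]
    ring
  rw [hneg, PowerSeries.coeff_C_mul, div_mul_eq_mul_div, mul_left_comm, hcoeff, FF,
    div_mul_eq_mul_div]
  congr 1
  rw [Finset.mul_sum, Finset.mul_sum]
  refine Finset.sum_congr rfl fun μ hμ => ?_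
  simp only [comps, Finset.mem_filter] at hμ
  obtain ⟨-, h0, hs⟩ := hμ
  have hdeg : ∑ i : Fin (r + 2), ((i.val : ℤ) - 1) * μ i = (compsDegree μ : ℤ) := by
    rw [sum_fin_eq_add_sum_sdiff, compsDegree, Nat.cast_sum, h0]
    simp only [Fin.val_one, Nat.cast_zero, mul_zero, Nat.cast_one, sub_self, zero_mul, zero_add]
    refine Finset.sum_congr rfl fun i hi => ?_
    have hi1 : 1 ≤ i.val := by
      simp only [Finset.mem_sdiff, Finset.mem_univ, true_and, Finset.mem_insert,
        Finset.mem_singleton, not_or, Fin.ext_iff, Fin.val_zero, Fin.val_one] at hi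
      omega
    push_cast [Nat.cast_sub hi1]
    ring
  rw [sum_fin_eq_add_sum_sdiff, h0, zero_add] at hs
  rw [hdeg, PowerSeries.coeff_mul_X_pow', compsWeight]
  split_ifs with hle
  · rw [coeff_powSeries]
    have hN : (r : ℤ) - compsDegree μ - ((a : ℤ) - 1) =
        ((r + 1 - a - compsDegree μ : ℕ) : ℤ) := by omega
    rw [hN, ← Nat.cast_sum]
    set k := ∑ i ∈ Finset.univ \ ({0, 1} : Finset (Fin (r + 2))), μ i with hk
    have hsign : (-1 : ℂ) ^ (r + 1) * (-1) ^ k = -(-1) ^ μ 1 := by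
      have hr : (-1 : ℂ) ^ (r + 1) = (-1) ^ (μ 1 + k + 1) := by rw [hs]
      rw [hr]
      have hsq : (-1 : ℂ) ^ k * (-1) ^ k = 1 := by rw [← mul_pow]; simp
      linear_combination -(-1 : ℂ) ^ μ 1 * hsq
    have hc1 : c 1 ^ (-((r : ℤ) + 1 + (k : ℤ))) = (c 1)⁻¹ ^ (r + 1 + k) := by
      rw [zpow_neg, inv_pow, ← zpow_natCast]
      push_cast
      rfl
    rw [hc1]
    generalize (∏ i ∈ Finset.univ \ ({0, 1} : Finset (Fin (r + 2))),
      (c i ^ μ i / (Nat.factorial (μ i) : ℂ))) = p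
    linear_combination -(α ^ x * gbinom x ((r + 1 - a - compsDegree μ : ℕ) : ℤ) *
      α ^ (-((r + 1 - a - compsDegree μ : ℕ) : ℤ)) * (Nat.factorial (r + k) : ℂ) *
      (c 1)⁻¹ ^ (r + 1 + k) * p) * hsign
  · have hgb : gbinom x ((r : ℤ) - compsDegree μ - ((a : ℤ) - 1)) = 0 :=
      if_neg (by omega)
    rw [hgb]
    simp only [mul_zero, zero_mul]

theorem F_product_over_partitions
    (α : ℂ) (hα : α ≠ 0) (c : ℕ → ℂ) (hc : c 1 ≠ 0)
    (M a : ℕ) (ha : 1 ≤ a) (haM : a ≤ M) (x : ℕ → ℂ) :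
    ∑ P ∈ setPartitions (Finset.Icc 1 M) a,
        ∏ B ∈ P, FF α c (∑ m ∈ B, x m) (B.card - 1) 1 =
      FF α c (∑ i ∈ Finset.Icc 1 M, x i) (M - 1) a := by
  set ψ : ℕ → PowerSeries ℂ := fun m => powSeries α (x m) * -invSeries c with hψ
  have hprod : ∀ B : Finset ℕ,
      ∏ m ∈ B, ψ m = powSeries α (∑ m ∈ B, x m) * (-invSeries c) ^ #B := by
    intro B
    rw [hψ, Finset.prod_mul_distrib, prod_powSeries hα, Finset.prod_const]
  have hcard : #(Finset.Icc 1 M) = M := by simp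
  have hrhs := FF_eq_coeff_s1 (α := α) hc (∑ i ∈ Finset.Icc 1 M, x i) (r := M - 1) ha (by omega)
  have hmain := sum_setPartitions_coeff ψ (S := Finset.Icc 1 M) ha (by omega)
  rw [hcard, hprod, hcard] at hmain
  rw [show M - 1 + 1 = M by omega] at hrhs
  rw [hrhs, ← hmain]
  refine Finset.sum_congr rfl fun P hP => Finset.prod_congr rfl fun B hB => ?_
  have hpos := ((mem_setPartitions.1 hP).2.1 B hB).card_pos
  rw [FF_eq_coeff_s1 hc _ le_rfl (by omega), hprod, Nat.sub_add_cancel hpos, Nat.sub_self,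
    Nat.factorial_zero, Nat.cast_one, div_one]
end

section
/- Under these hypotheses, for every multi-index n = (n₁,…,n_d) ∈ ℕ^d with Σn ≥ 1, the quantity ∂(φ,n)/(n₁!·n₂!·⋯·n_d!) equals α^{Σ_{i=1}^d n_i γ_i} times an element of the smallest subring of ℂ containing α^{−1}, c₁^{−1}, and c₂, c₃, …, c_{Σn} (here α^{Σ n_i γ_i} is an integer power of α, since each γ_i is an integer). -/
open Finset Complex


open Asymptotics Filter Topology

section PartialDerivatives

variable {d : ℕ} {U : Set (Fin d → ℂ)} {f h : (Fin d → ℂ) → ℂ}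

theorem pderivC_eq_fderiv {a : Fin d → ℂ} (hf : DifferentiableAt ℂ f a) (i : Fin d) :
    pderivC i f a = fderiv ℂ f a (Pi.single i 1) := by
  have hf' : HasFDerivAt f (fderiv ℂ f a) (Function.update a i (a i)) := by
    simpa using hf.hasFDerivAt
  exact (hf'.comp_hasDerivAt (a i) (hasDerivAt_update a i (a i))).deriv

theorem contDiffOn_pderivC (hU : IsOpen U) (hf : ContDiffOn ℂ (⊤ : ℕ∞) f U) (i : Fin d) :
    ContDiffOn ℂ (⊤ : ℕ∞) (pderivC i f) U := by
  have h1 : ContDiffOn ℂ (⊤ : ℕ∞) (fun a => fderiv ℂ f a (Pi.single i 1)) U :=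
    (hf.fderiv_of_isOpen hU (by simp)).clm_apply contDiffOn_const
  refine h1.congr fun a ha => pderivC_eq_fderiv ?_ i
  exact (hf.contDiffAt (hU.mem_nhds ha)).differentiableAt (by simp)

theorem eqOn_pderivC (hU : IsOpen U) (hfh : Set.EqOn f h U) (i : Fin d) :
    Set.EqOn (pderivC i f) (pderivC i h) U := by
  intro a ha
  refine Filter.EventuallyEq.deriv_eq ?_
  have hc : ContinuousAt (fun t => Function.update a i t) (a i) :=
    (hasDerivAt_update a i (a i)).continuousAt
  have : ∀ᶠ t in 𝓝 (a i), Function.update a i t ∈ U :=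
    hc.eventually_mem (by simpa using hU.mem_nhds ha)
  filter_upwards [this] with t ht using hfh ht

theorem contDiffOn_foldr_pderivC (hU : IsOpen U) (hf : ContDiffOn ℂ (⊤ : ℕ∞) f U)
    (l : List (Fin d)) : ContDiffOn ℂ (⊤ : ℕ∞) (l.foldr pderivC f) U := by
  induction l with
  | nil => exact hf
  | cons i l ih => exact contDiffOn_pderivC hU ih i

theorem foldr_pderivC_sub (hU : IsOpen U) (hf : ContDiffOn ℂ (⊤ : ℕ∞) f U)
    (hh : ContDiffOn ℂ (⊤ : ℕ∞) h U) (l : List (Fin d)) :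
    Set.EqOn (l.foldr pderivC (f - h)) (l.foldr pderivC f - l.foldr pderivC h) U := by
  induction l with
  | nil => exact Set.eqOn_refl _ _
  | cons i l ih =>
    intro a ha
    have hdiff {u : (Fin d → ℂ) → ℂ} (hu : ContDiffOn ℂ (⊤ : ℕ∞) u U) :
        DifferentiableAt ℂ u a :=
      (hu.contDiffAt (hU.mem_nhds ha)).differentiableAt (by simp)
    have h1 := hdiff (contDiffOn_foldr_pderivC hU hf l)
    have h2 := hdiff (contDiffOn_foldr_pderivC hU hh l)
    simp only [List.foldr_cons, Pi.sub_apply]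
    rw [eqOn_pderivC hU ih i ha, pderivC_eq_fderiv (h1.sub h2), pderivC_eq_fderiv h1,
      pderivC_eq_fderiv h2, fderiv_sub h1 h2]
    rfl

theorem norm_update_sub_le (a : Fin d → ℂ) (i : Fin d) (t : ℂ) :
    ‖Function.update a i t - a‖ ≤ ‖t - a i‖ := by
  refine (pi_norm_le_iff_of_nonneg (norm_nonneg _)).2 fun j => ?_
  by_cases hj : j = i
  · subst hj; simp
  · simp [hj]

/-- Cauchy's estimate: differentiating lowers the order of vanishing at `0` by at most one. -/
theorem pderivC_bound {k : ℕ} (hU : U ∈ 𝓝 0) (hf : DifferentiableOn ℂ f U)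
    (hk : ∃ C ε : ℝ, 0 < ε ∧ ∀ r, 0 < r → r < ε → ∀ a, ‖a‖ ≤ r → ‖f a‖ ≤ C * r ^ (k + 1))
    (i : Fin d) :
    ∃ C ε : ℝ, 0 < ε ∧ ∀ r, 0 < r → r < ε → ∀ a, ‖a‖ ≤ r → ‖pderivC i f a‖ ≤ C * r ^ k := by
  obtain ⟨C, ε, hε, hC⟩ := hk
  obtain ⟨δ, hδ, hδU⟩ := Metric.mem_nhds_iff.1 hU
  refine ⟨C * 2 ^ (k + 1), min (ε / 2) (δ / 2), by positivity, fun r hr hrε a ha => ?_⟩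
  have hr1 : 2 * r < ε := by linarith [hrε.trans_le (min_le_left _ _)]
  have hr2 : 2 * r < δ := by linarith [hrε.trans_le (min_le_right _ _)]
  have hnorm : ∀ t, ‖t - a i‖ ≤ r → ‖Function.update a i t‖ ≤ 2 * r := fun t ht => by
    have := norm_add_le (Function.update a i t - a) a
    rw [sub_add_cancel] at this
    linarith [norm_update_sub_le a i t]
  have hdiff : DifferentiableOn ℂ (fun t => f (Function.update a i t))
      (Metric.closedBall (a i) r) := by
    refine hf.comp (fun t _ => (hasDerivAt_update a i t).differentiableAt.differentiableWithinAt)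
      fun t ht => hδU ?_
    have := hnorm t (by simpa [dist_eq_norm] using ht)
    simpa using this.trans_lt hr2
  have key := Complex.norm_deriv_le_of_forall_mem_sphere_norm_le hr
    (hdiff.diffContOnCl_ball subset_rfl) (C := C * (2 * r) ^ (k + 1)) fun t ht =>
      hC (2 * r) (by positivity) hr1 _ (hnorm t (by simpa [dist_eq_norm] using ht.le))
  refine key.trans_eq ?_
  rw [mul_pow, pow_succ r]
  field_simp

theorem foldr_pderivC_bound (hU : IsOpen U) (h0U : 0 ∈ U) (hf : ContDiffOn ℂ (⊤ : ℕ∞) f U)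
    (l : List (Fin d)) (k : ℕ)
    (hk : ∃ C ε : ℝ, 0 < ε ∧
      ∀ r, 0 < r → r < ε → ∀ a, ‖a‖ ≤ r → ‖f a‖ ≤ C * r ^ (k + l.length)) :
    ∃ C ε : ℝ, 0 < ε ∧
      ∀ r, 0 < r → r < ε → ∀ a, ‖a‖ ≤ r → ‖l.foldr pderivC f a‖ ≤ C * r ^ k := by
  induction l generalizing k with
  | nil => simpa using hk
  | cons i l ih =>
    refine pderivC_bound (hU.mem_nhds h0U)
      ((contDiffOn_foldr_pderivC hU hf l).differentiableOn (by simp)) (ih (k + 1) ?_) i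
    simpa only [List.length_cons, add_assoc, add_comm 1] using hk

theorem foldr_pderivC_eq_zero_of_isBigO (hU : IsOpen U) (h0U : 0 ∈ U)
    (hf : ContDiffOn ℂ (⊤ : ℕ∞) f U) (l : List (Fin d))
    (hO : f =O[𝓝 0] fun a => ‖a‖ ^ (l.length + 1)) : l.foldr pderivC f 0 = 0 := by
  obtain ⟨C, hC⟩ := hO.bound
  obtain ⟨ε, hε, hball⟩ := Metric.eventually_nhds_iff.1 hC
  have hb : ∃ C ε : ℝ, 0 < ε ∧
      ∀ r, 0 < r → r < ε → ∀ a, ‖a‖ ≤ r → ‖f a‖ ≤ C * r ^ (1 + l.length) := by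
    refine ⟨|C|, ε, hε, fun r hr hrε a ha => ?_⟩
    refine (hball (by simpa using ha.trans_lt hrε)).trans ?_
    rw [norm_pow, norm_norm, add_comm 1]
    gcongr
    exact le_abs_self C
  obtain ⟨C', ε', hε', hC'⟩ := foldr_pderivC_bound hU h0U hf l 1 hb
  have hlim : Tendsto (fun r : ℝ => C' * r ^ 1) (𝓝[>] 0) (𝓝 0) := by
    have : Continuous fun r : ℝ => C' * r ^ 1 := by fun_prop
    simpa using (this.tendsto 0).mono_left nhdsWithin_le_nhds
  have hle : ‖l.foldr pderivC f 0‖ ≤ 0 := by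
    refine ge_of_tendsto hlim ?_
    filter_upwards [Ioo_mem_nhdsGT hε'] with r hr using hC' r hr.1 hr.2 0 (by simpa using hr.1.le)
  simpa using hle

theorem pderivC_eval (P : MvPolynomial (Fin d) ℂ) (i : Fin d) :
    pderivC i (fun a => MvPolynomial.eval a P) =
      fun a => MvPolynomial.eval a (MvPolynomial.pderiv i P) := by
  funext a
  suffices H : ∀ t, HasDerivAt (fun t => MvPolynomial.eval (Function.update a i t) P)
      (MvPolynomial.eval (Function.update a i t) (MvPolynomial.pderiv i P)) t by
    simpa [pderivC] using (H (a i)).deriv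
  intro t
  induction P using MvPolynomial.induction_on with
  | C r => simpa using hasDerivAt_const t r
  | add p q hp hq => simpa using hp.fun_add hq
  | mul_X p j hp =>
    have hX : HasDerivAt (fun t => Function.update a i t j) ((Pi.single i 1 : Fin d → ℂ) j) t :=
      hasDerivAt_pi.1 (hasDerivAt_update a i t) j
    have hX' : MvPolynomial.eval (Function.update a i t)
        (MvPolynomial.pderiv i (MvPolynomial.X j : MvPolynomial (Fin d) ℂ)) =
          (Pi.single i 1 : Fin d → ℂ) j := by
      rw [MvPolynomial.pderiv_X]
      by_cases hj : j = i
      · subst hj; simp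
      · simp [hj]
    rw [MvPolynomial.pderiv_mul, map_add, map_mul, map_mul, hX', MvPolynomial.eval_X]
    simpa only [map_mul, MvPolynomial.eval_X] using hp.fun_mul hX

theorem foldr_pderivC_eval (P : MvPolynomial (Fin d) ℂ) (l : List (Fin d)) :
    l.foldr pderivC (fun a => MvPolynomial.eval a P) =
      fun a => MvPolynomial.eval a (l.foldr (fun i p => MvPolynomial.pderiv i p) P) := by
  induction l with
  | nil => rfl
  | cons i l ih => rw [List.foldr_cons, ih, pderivC_eval, List.foldr_cons]

theorem coeff_foldr_pderiv (P : MvPolynomial (Fin d) ℂ) (l : List (Fin d)) (m : Fin d →₀ ℕ) :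
    (l.foldr (fun i p => MvPolynomial.pderiv i p) P).coeff m * ∏ j, ((m j).factorial : ℂ) =
      P.coeff (m + Finsupp.equivFunOnFinite.symm fun j => l.count j) *
        ∏ j, ((m j + l.count j).factorial : ℂ) := by
  induction l generalizing m with
  | nil =>
    have : Finsupp.equivFunOnFinite.symm (fun _ : Fin d => 0) = 0 := by ext; simp
    simp [this]
  | cons i l ih =>
    have hprod : ∏ j, (((m + Finsupp.single i 1 : Fin d →₀ ℕ) j).factorial : ℂ) =
        (m i + 1) * ∏ j, ((m j).factorial : ℂ) := by
      rw [← Finset.mul_prod_erase _ _ (Finset.mem_univ i),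
        ← Finset.mul_prod_erase _ (fun j => ((m j).factorial : ℂ)) (Finset.mem_univ i),
        ← mul_assoc]
      congr 1
      · simp [Nat.factorial_succ]
      · refine Finset.prod_congr rfl fun j hj => ?_
        simp [(Finset.ne_of_mem_erase hj).symm]
    have hidx (j : Fin d) :
        (m + Finsupp.single i 1 : Fin d →₀ ℕ) j + l.count j = m j + (i :: l).count j := by
      by_cases hj : i = j
      · subst hj; simp; ring
      · simp [hj]
    have hidx' : m + Finsupp.single i 1 + Finsupp.equivFunOnFinite.symm (fun j => l.count j) =
        m + Finsupp.equivFunOnFinite.symm fun j => (i :: l).count j := by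
      ext j
      simpa using hidx j
    have := ih (m + Finsupp.single i 1)
    rw [hprod, hidx'] at this
    simp only [hidx] at this
    rw [List.foldr_cons, MvPolynomial.coeff_pderiv, ← this]
    ring

theorem mixedPartial_eq_foldr (n : Fin d → ℕ) (f : (Fin d → ℂ) → ℂ) :
    mixedPartial n f =
      ((List.finRange d).flatMap fun i => List.replicate (n i) i).foldr pderivC f := by
  have hrep (i : Fin d) (k : ℕ) (u : (Fin d → ℂ) → ℂ) :
      (List.replicate k i).foldr pderivC u = (pderivC i)^[k] u := by
    induction k with
    | zero => rfl
    | succ k ih => rw [List.replicate_succ, List.foldr_cons, ih, Function.iterate_succ_apply']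
  rw [mixedPartial, List.ofFn_eq_map]
  induction List.finRange d with
  | nil => rfl
  | cons i L ih => simp [List.foldr_append, hrep, ← ih]

theorem count_flatMap_replicate (n : Fin d → ℕ) (j : Fin d) :
    ((List.finRange d).flatMap fun i => List.replicate (n i) i).count j = n j := by
  rw [List.count_flatMap, ← Fin.sum_univ_def]
  simp [List.count_replicate]

theorem mixedPartial_eval_zero (n : Fin d → ℕ) (P : MvPolynomial (Fin d) ℂ) :
    mixedPartial n (fun a => MvPolynomial.eval a P) 0 =
      P.coeff (Finsupp.equivFunOnFinite.symm n) * ∏ j, ((n j).factorial : ℂ) := by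
  have := coeff_foldr_pderiv P ((List.finRange d).flatMap fun i => List.replicate (n i) i) 0
  simp only [count_flatMap_replicate] at this
  rw [mixedPartial_eq_foldr, foldr_pderivC_eval]
  simpa [← MvPolynomial.constantCoeff_eq] using this

/-- Functions agreeing to order `∑ i, n i` at `0` have the same `n`-th mixed partial there. -/
theorem mixedPartial_eq_of_isBigO (hU : IsOpen U) (h0U : 0 ∈ U)
    (hf : ContDiffOn ℂ (⊤ : ℕ∞) f U) (hh : ContDiffOn ℂ (⊤ : ℕ∞) h U) (n : Fin d → ℕ)
    (hO : (fun a => f a - h a) =O[𝓝 0] fun a => ‖a‖ ^ ((∑ i, n i) + 1)) :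
    mixedPartial n f 0 = mixedPartial n h 0 := by
  simp only [mixedPartial_eq_foldr]
  set l := (List.finRange d).flatMap fun i => List.replicate (n i) i with hl
  have hlen : l.length = ∑ i, n i := by
    rw [hl, List.length_flatMap, Fin.sum_univ_def]
    simp
  have h0 := foldr_pderivC_eq_zero_of_isBigO hU h0U (hf.sub hh) l (by rw [hlen]; exact hO)
  have h1 := foldr_pderivC_sub hU hf hh l h0U
  rw [Pi.sub_apply] at h1
  exact sub_eq_zero.1 (h1.symm.trans h0)

theorem contDiff_eval (P : MvPolynomial (Fin d) ℂ) :
    ContDiff ℂ (⊤ : ℕ∞) fun a => MvPolynomial.eval a P := by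
  induction P using MvPolynomial.induction_on with
  | C r => simpa using contDiff_const
  | add p q hp hq => simpa using hp.add hq
  | mul_X p j hp => simpa using hp.mul (contDiff_apply ℂ ℂ j)

end PartialDerivatives

section Taylor

theorem isBigO_taylor {g : ℂ → ℂ} {α : ℂ} (hg : AnalyticAt ℂ g α) (k : ℕ) :
    (fun y => g (α + y) - ∑ j ∈ range k, iteratedDeriv j g α / (j.factorial : ℂ) * y ^ j)
      =O[𝓝 0] fun y => ‖y‖ ^ k := by
  have := hg.hasFPowerSeriesAt.isBigO_sub_partialSum_pow k
  simpa [FormalMultilinearSeries.partialSum, FormalMultilinearSeries.ofScalars_apply_eq,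
    mul_comm] using this

theorem exists_int_iteratedDeriv_zpow {α : ℂ} (hα : α ≠ 0) (γ : ℤ) (j : ℕ) :
    ∃ e : ℤ, iteratedDeriv j (fun z : ℂ => z ^ γ) α / (j.factorial : ℂ) =
      α ^ γ * (e * α⁻¹ ^ j) := by
  obtain ⟨e, he⟩ := Nat.factorial_coe_dvd_prod j (-γ)
  refine ⟨(-1) ^ j * e, ?_⟩
  have hprod : ∏ i ∈ range j, ((γ : ℂ) - i) = (-1) ^ j * (j.factorial * e) := by
    have he' : ∏ i ∈ range j, (-(γ : ℂ) + i) = j.factorial * e := by exact_mod_cast he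
    rw [← he']
    calc ∏ i ∈ range j, ((γ : ℂ) - i) = ∏ i ∈ range j, (-1) * (-(γ : ℂ) + i) :=
          Finset.prod_congr rfl fun i _ => by ring
      _ = _ := by rw [Finset.prod_mul_distrib]; simp
  have hf : (j.factorial : ℂ) ≠ 0 := by exact_mod_cast j.factorial_ne_zero
  rw [iteratedDeriv_eq_iterate, iter_deriv_zpow, hprod, zpow_sub₀ hα, zpow_natCast, inv_pow]
  push_cast
  field_simp

theorem isBigO_pow_succ_sub_pow_succ {E : Type*} [NormedAddCommGroup E] {u v : E → ℂ} {m : ℕ}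
    (hu : u =O[𝓝 0] fun a => ‖a‖ ^ 1) (hv : v =O[𝓝 0] fun a => ‖a‖ ^ 1)
    (huv : (fun a => u a - v a) =O[𝓝 0] fun a => ‖a‖ ^ m) (j : ℕ) :
    (fun a => u a ^ (j + 1) - v a ^ (j + 1)) =O[𝓝 0] fun a => ‖a‖ ^ (m + j) := by
  induction j with
  | zero => simpa using huv
  | succ j ih =>
    have h1 := (hu.pow (j + 1)).mul huv
    have h2 := ih.mul hv
    have h3 : (fun a => u a ^ (j + 1) * (u a - v a) + (u a ^ (j + 1) - v a ^ (j + 1)) * v a)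
        =O[𝓝 0] fun a => ‖a‖ ^ (m + (j + 1)) :=
      (h1.congr_right fun a => by ring).add (h2.congr_right fun a => by ring)
    exact h3.congr_left fun a => by ring

theorem isBigO_norm_pow_of_le {E : Type*} [NormedAddCommGroup E] {u : E → ℂ} {k m : ℕ}
    (hkm : k ≤ m) (hu : u =O[𝓝 0] fun a => ‖a‖ ^ m) : u =O[𝓝 0] fun a => ‖a‖ ^ k := by
  refine hu.trans (IsBigO.of_bound 1 ?_)
  filter_upwards [Metric.ball_mem_nhds (0 : E) one_pos] with a ha
  rw [norm_pow, norm_pow, norm_norm, one_mul]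
  exact pow_le_pow_of_le_one (norm_nonneg a) (by simpa using (mem_ball_zero_iff.1 ha).le) hkm

end Taylor

/-- Polynomials whose coefficient at `m` lies in `α ^ (∑ i, m i * γ i) • R` for every `m`. -/
def twistedSubring {d : ℕ} (R : Subring ℂ) {α : ℂ} (hα : α ≠ 0) (γ : Fin d → ℤ) :
    Subring (MvPolynomial (Fin d) ℂ) where
  carrier := {P | ∀ m : Fin d →₀ ℕ, P.coeff m * α ^ (-∑ i, (m i : ℤ) * γ i) ∈ R}
  mul_mem' {P Q} hP hQ m := by
    rw [MvPolynomial.coeff_mul, Finset.sum_mul]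
    refine sum_mem fun x hx => ?_
    have : α ^ (-∑ i, (m i : ℤ) * γ i) =
        α ^ (-∑ i, (x.1 i : ℤ) * γ i) * α ^ (-∑ i, (x.2 i : ℤ) * γ i) := by
      rw [← zpow_add₀ hα, ← Finset.HasAntidiagonal.mem_antidiagonal.1 hx, ← neg_add, ← Finset.sum_add_distrib]
      simp [add_mul]
    rw [this, mul_mul_mul_comm]
    exact mul_mem (hP _) (hQ _)
  one_mem' m := by
    classical
    rw [MvPolynomial.coeff_one]
    split_ifs with h
    · subst h; simp
    · simp
  add_mem' {P Q} hP hQ m := by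
    rw [MvPolynomial.coeff_add, add_mul]
    exact add_mem (hP m) (hQ m)
  zero_mem' m := by simp
  neg_mem' {P} hP m := by
    rw [MvPolynomial.coeff_neg, neg_mul]
    exact neg_mem (hP m)

section TwistedSubring

variable {d : ℕ} {R : Subring ℂ} {α : ℂ} (hα : α ≠ 0) (γ : Fin d → ℤ)

theorem C_mem_twistedSubring {r : ℂ} (hr : r ∈ R) :
    MvPolynomial.C r ∈ twistedSubring R hα γ := fun m => by
  classical
  rw [MvPolynomial.coeff_C]
  split_ifs with h
  · subst h; simpa using hr
  · simp

theorem C_mul_X_mem_twistedSubring (i : Fin d) :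
    MvPolynomial.C (α ^ γ i) * MvPolynomial.X i ∈ twistedSubring R hα γ := fun m => by
  classical
  rw [MvPolynomial.coeff_C_mul, MvPolynomial.coeff_X]
  split_ifs with h
  · subst h
    have : ∑ j, ((Finsupp.single i 1 : Fin d →₀ ℕ) j : ℤ) * γ j = γ i := by
      simp [Finsupp.single_apply]
    rw [this, mul_one, ← zpow_add₀ hα]
    simp
  · simp

end TwistedSubring

/-- The implicit function is approximated to every order up to `N + 1` by polynomials in
the twisted subring. -/
theorem exists_twisted_approx {d : ℕ} (R : Subring ℂ) {α : ℂ} (hα : α ≠ 0) (γ : Fin d → ℤ)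
    {g : ℂ → ℂ} (hg : AnalyticAt ℂ g α) (hgα : g α = 0) {c : ℕ → ℂ}
    (hc : ∀ k, c k = iteratedDeriv k g α / (k.factorial : ℂ)) (hc1 : c 1 ≠ 0) {N : ℕ}
    (hαR : α⁻¹ ∈ R) (hc1R : (c 1)⁻¹ ∈ R) (hcR : ∀ k, 2 ≤ k → k ≤ N → c k ∈ R)
    {ψ : (Fin d → ℂ) → ℂ} (hψ : ψ =O[𝓝 0] fun a => ‖a‖ ^ 1)
    (hzero : ∀ᶠ a in 𝓝 0, g (α + ψ a) + ∑ i, a i * (α + ψ a) ^ γ i = 0) (k : ℕ) (hk : k ≤ N) :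
    ∃ P ∈ twistedSubring R hα γ,
      (fun a => ψ a - MvPolynomial.eval a P) =O[𝓝 0] fun a => ‖a‖ ^ (k + 1) := by
  induction k with
  | zero => exact ⟨0, zero_mem _, by simpa using hψ⟩
  | succ k ih =>
    obtain ⟨P, hP, hPψ⟩ := ih (by omega)
    choose e he using fun i j => exists_int_iteratedDeriv_zpow hα (γ i) j
    have hψ0 : Tendsto ψ (𝓝 0) (𝓝 0) := by
      refine hψ.trans_tendsto ?_
      have : Continuous fun a : Fin d → ℂ => ‖a‖ ^ 1 := by fun_prop
      simpa using this.tendsto 0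
    have hPO : (fun a => MvPolynomial.eval a P) =O[𝓝 0] fun a => ‖a‖ ^ 1 :=
      (hψ.sub (isBigO_norm_pow_of_le (by omega) hPψ)).congr_left fun a => by ring
    have happ (i : Fin d) : (fun a : Fin d → ℂ => a i) =O[𝓝 0] fun a => ‖a‖ ^ 1 :=
      IsBigO.of_bound 1 (Eventually.of_forall fun a => by simpa using norm_le_pi_norm a i)
    let A : MvPolynomial (Fin d) ℂ := ∑ j ∈ range k, MvPolynomial.C (c (j + 2)) * P ^ (j + 2)
    let B : MvPolynomial (Fin d) ℂ := ∑ i, (MvPolynomial.C (α ^ γ i) * MvPolynomial.X i) *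
      ∑ j ∈ range (k + 1), MvPolynomial.C (e i j * α⁻¹ ^ j) * P ^ j
    refine ⟨-(MvPolynomial.C (c 1)⁻¹ * (A + B)), ?_, ?_⟩
    · refine neg_mem (mul_mem (C_mem_twistedSubring hα γ hc1R) (add_mem ?_ ?_))
      · refine sum_mem fun j hj => mul_mem (C_mem_twistedSubring hα γ (hcR _ ?_ ?_)) (pow_mem hP _)
        · omega
        · have := Finset.mem_range.1 hj
          omega
      · refine sum_mem fun i _ => mul_mem (C_mul_X_mem_twistedSubring hα γ i) (sum_mem fun j _ =>
          mul_mem (C_mem_twistedSubring hα γ (mul_mem (intCast_mem R _) (pow_mem hαR _)))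
            (pow_mem hP _))
    · have hc0 : c 0 = 0 := by rw [hc]; simp [hgα]
      have hg2 : (fun a => g (α + ψ a) - (c 1 * ψ a + ∑ j ∈ range k, c (j + 2) * ψ a ^ (j + 2)))
          =O[𝓝 0] fun a => ‖a‖ ^ (k + 1 + 1) := by
        refine (((isBigO_taylor hg (k + 2)).comp_tendsto hψ0).trans
          ((hψ.norm_left.pow (k + 2)).congr_right fun a => by ring)).congr_left fun a => ?_
        simp only [Function.comp_apply, ← hc]
        rw [Finset.sum_range_succ', Finset.sum_range_succ', hc0]
        ring
      have hz2 (i : Fin d) : (fun a : Fin d → ℂ => a i * ((α + ψ a) ^ γ i -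
          ∑ j ∈ range (k + 1), α ^ γ i * (e i j * α⁻¹ ^ j) * ψ a ^ j))
          =O[𝓝 0] fun a => ‖a‖ ^ (k + 1 + 1) := by
        have hz : AnalyticAt ℂ (fun z : ℂ => z ^ γ i) α := analyticAt_id.zpow hα
        have h1 := ((isBigO_taylor hz (k + 1)).comp_tendsto hψ0).trans
          (hψ.norm_left.pow (k + 1))
        refine ((happ i).mul h1).congr (fun a => ?_) fun a => by ring
        simp only [Function.comp_apply, ← he]
      have hpow (j : ℕ) := isBigO_pow_succ_sub_pow_succ hψ hPO hPψ j
      have hA : (fun a => ∑ j ∈ range k,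
          c (j + 2) * (ψ a ^ (j + 2) - MvPolynomial.eval a P ^ (j + 2)))
          =O[𝓝 0] fun a => ‖a‖ ^ (k + 1 + 1) :=
        IsBigO.fun_sum fun j _ =>
          (isBigO_norm_pow_of_le (by omega) (hpow (j + 1))).const_mul_left (c (j + 2))
      have hB (i : Fin d) : (fun a : Fin d → ℂ => a i * ∑ j ∈ range (k + 1),
          α ^ γ i * (e i j * α⁻¹ ^ j) * (ψ a ^ j - MvPolynomial.eval a P ^ j))
          =O[𝓝 0] fun a => ‖a‖ ^ (k + 1 + 1) := by
        have h1 : (fun a : Fin d → ℂ => ∑ j ∈ range (k + 1),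
            α ^ γ i * (e i j * α⁻¹ ^ j) * (ψ a ^ j - MvPolynomial.eval a P ^ j))
            =O[𝓝 0] fun a => ‖a‖ ^ (k + 1) := by
          refine IsBigO.fun_sum fun j _ => IsBigO.const_mul_left ?_ _
          cases j with
          | zero => simpa using isBigO_zero _ _
          | succ j => exact isBigO_norm_pow_of_le (by omega) (hpow j)
        exact ((happ i).mul h1).congr_right fun a => by ring
      have htot := (((hg2.add (IsBigO.fun_sum fun i (_ : i ∈ univ) => hz2 i)).add hA).add
        (IsBigO.fun_sum fun i (_ : i ∈ univ) => hB i)).const_mul_left (-(c 1)⁻¹)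
      refine htot.congr' ?_ EventuallyEq.rfl
      filter_upwards [hzero] with a ha
      have hsplit : ∑ i, a i * (α + ψ a) ^ γ i =
          ∑ i, a i * ((α + ψ a) ^ γ i -
            ∑ j ∈ range (k + 1), α ^ γ i * (e i j * α⁻¹ ^ j) * ψ a ^ j) +
          ∑ i, a i * ∑ j ∈ range (k + 1),
            α ^ γ i * (e i j * α⁻¹ ^ j) * (ψ a ^ j - MvPolynomial.eval a P ^ j) +
          MvPolynomial.eval a B := by
        simp only [B, map_sum, map_mul, map_pow, MvPolynomial.eval_C, MvPolynomial.eval_X]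
        rw [← Finset.sum_add_distrib, ← Finset.sum_add_distrib]
        refine Finset.sum_congr rfl fun i _ => ?_
        simp only [mul_sub, Finset.sum_sub_distrib, Finset.mul_sum, mul_assoc, mul_left_comm (a i)]
        ring
      have hsplitA : ∑ j ∈ range k, c (j + 2) * ψ a ^ (j + 2) =
          ∑ j ∈ range k, c (j + 2) * (ψ a ^ (j + 2) - MvPolynomial.eval a P ^ (j + 2)) +
          MvPolynomial.eval a A := by
        simp only [A, map_sum, map_mul, map_pow, MvPolynomial.eval_C]
        rw [← Finset.sum_add_distrib]
        exact Finset.sum_congr rfl fun j _ => by ring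
      have hψa : ψ a = (c 1)⁻¹ * (c 1 * ψ a) := by rw [inv_mul_cancel_left₀ hc1]
      simp only [map_neg, map_mul, map_add, MvPolynomial.eval_C]
      rw [hsplitA]
      linear_combination (-(c 1)⁻¹) * ha + (c 1)⁻¹ * hsplit - hψa

theorem taylor_coefficient_integrality
    {d : ℕ} (hd : 1 ≤ d) (γ : Fin d → ℤ) (α : ℂ) (hα : α ≠ 0)
    (g : ℂ → ℂ) (hg : AnalyticAt ℂ g α) (hgα : g α = 0) (hg' : deriv g α ≠ 0)
    (c : ℕ → ℂ) (hc : ∀ k, c k = iteratedDeriv k g α / (Nat.factorial k : ℂ))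
    (U : Set (Fin d → ℂ)) (hU : IsOpen U) (h0U : (0 : Fin d → ℂ) ∈ U)
    (φ : (Fin d → ℂ) → ℂ) (hφ : ContDiffOn ℂ (⊤ : ℕ∞) φ U)
    (hφ0 : φ 0 = α) (hφne : ∀ a ∈ U, φ a ≠ 0)
    (hzero : ∀ a ∈ U, g (φ a) + ∑ i, a i * φ a ^ γ i = 0)
    (n : Fin d → ℕ) (hn : 1 ≤ ∑ i, n i) :
    ∃ z ∈ Subring.closure
        ({α⁻¹, (c 1)⁻¹} ∪ {w : ℂ | ∃ k : ℕ, 2 ≤ k ∧ k ≤ (∑ i, n i) ∧ w = c k}),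
      mixedPartial n φ 0 / ∏ i, ((Nat.factorial (n i)) : ℂ) =
        α ^ (∑ i, (n i : ℤ) * γ i) * z := by
  have hφ0O : (fun a => φ a - α) =O[𝓝 0] fun a => ‖a‖ ^ 1 := by
    have hd0 : DifferentiableAt ℂ φ 0 :=
      (hφ.contDiffAt (hU.mem_nhds h0U)).differentiableAt (by simp)
    simpa [hφ0] using hd0.isBigO_sub.norm_right
  have hc1 : c 1 ≠ 0 := by simpa [hc] using hg'
  set N := ∑ i, n i with hN
  set R := Subring.closure
    ({α⁻¹, (c 1)⁻¹} ∪ {w : ℂ | ∃ k : ℕ, 2 ≤ k ∧ k ≤ N ∧ w = c k}) with hR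
  obtain ⟨P, hP, hO⟩ := exists_twisted_approx (N := N) R hα γ hg hgα hc hc1
    (Subring.subset_closure (by simp)) (Subring.subset_closure (by simp))
    (fun k hk hkN => Subring.subset_closure (Or.inr ⟨k, hk, hkN, rfl⟩)) hφ0O
    (by filter_upwards [hU.mem_nhds h0U] with a ha using by simpa using hzero a ha) N le_rfl
  have hmp : mixedPartial n φ 0 =
      (P + MvPolynomial.C α).coeff (Finsupp.equivFunOnFinite.symm n) *
        ∏ j, ((n j).factorial : ℂ) := by
    rw [← mixedPartial_eval_zero]
    refine mixedPartial_eq_of_isBigO hU h0U hφ (contDiff_eval _).contDiffOn n ?_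
    refine hO.congr_left fun a => ?_
    rw [map_add, MvPolynomial.eval_C]
    ring
  have hn0 : (0 : Fin d →₀ ℕ) ≠ Finsupp.equivFunOnFinite.symm n := by
    intro h
    have h' (i : Fin d) : n i = 0 := by simpa using (DFunLike.congr_fun h i).symm
    simp [hN, h'] at hn
  have hfac : ∏ j, ((n j).factorial : ℂ) ≠ 0 :=
    Finset.prod_ne_zero_iff.2 fun j _ => by exact_mod_cast (n j).factorial_ne_zero
  refine ⟨_, hP (Finsupp.equivFunOnFinite.symm n), ?_⟩
  rw [hmp, mul_div_cancel_right₀ _ hfac, MvPolynomial.coeff_add, MvPolynomial.coeff_C,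
    if_neg hn0, add_zero, mul_left_comm, ← zpow_add₀ hα]
  simp
end

section
/- Let R be a commutative ring and δ : R → R a derivation. For every integer M ≥ 0 and elements f_A, f_B, f₁,…,f_M ∈ R: Σ_{w ⊆ {1,…,M}} T(w) = δ^M(f_A·f_B·∏_{i=1}^M f_i), where for a subset w ⊊ {1,…,M} the term is T(w) = δ^{M−|w|−1}(δ(f_A)·∏_{i∈{1,…,M}∖w} f_i)·δ^{|w|}(f_B·∏_{i∈w} f_i), and for w = {1,…,M} the term is T(w) = f_A·δ^{M}(f_B·∏_{i=1}^M f_i) (i.e., when the complement of w is empty, δ^{−1}(δ f_A) is interpreted as f_A). -/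
open Finset

section SubsetConvolution

variable {ι R : Type*} [DecidableEq ι] [CommRing R]

/-- The iterated derivative `D^|s| (b * ∏ i ∈ s, f i)`. -/
def derivProd (D : Derivation ℤ R R) (f : ι → R) (s : Finset ι) (b : R) : R :=
  D^[#s] (b * ∏ i ∈ s, f i)

/-- The iterated derivative `D^(|s| - 1) (D a * ∏ i ∈ s, f i)`, read as `a` for `s = ∅`. -/
def derivProdPred (D : Derivation ℤ R R) (f : ι → R) (s : Finset ι) (a : R) : R :=
  if s = ∅ then a else D^[#s - 1] (D a * ∏ i ∈ s, f i)

variable (D : Derivation ℤ R R) (f : ι → R)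

theorem derivProd_insert {s : Finset ι} {i : ι} (hi : i ∉ s) (b : R) :
    derivProd D f (insert i s) b = D (derivProd D f s (b * f i)) := by
  simp only [derivProd, card_insert_of_notMem hi, prod_insert hi,
    Function.iterate_succ_apply', mul_assoc]

theorem derivProdPred_insert {s : Finset ι} {i : ι} (hi : i ∉ s) (a : R) :
    derivProdPred D f (insert i s) a = derivProd D f s (D a * f i) := by
  simp [derivProd, derivProdPred, card_insert_of_notMem hi, prod_insert hi, mul_assoc]

theorem derivation_derivProdPred (s : Finset ι) (a : R) :
    D (derivProdPred D f s a) = derivProd D f s (D a) := by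
  rcases s.eq_empty_or_nonempty with rfl | hs
  · simp [derivProd, derivProdPred]
  · rw [derivProd, derivProdPred, if_neg hs.ne_empty, ← Function.iterate_succ_apply' D,
      Nat.succ_eq_add_one, Nat.sub_add_cancel hs.card_pos]

/-- Both sides sum over the ordered partitions of `s` into three parts. -/
theorem sum_powerset_sdiff_assoc (F G H : Finset ι → R) (s : Finset ι) :
    ∑ w ∈ s.powerset, (∑ u ∈ (s \ w).powerset, G ((s \ w) \ u) * F u) * H w =
      ∑ w ∈ s.powerset, F (s \ w) * ∑ u ∈ w.powerset, G (w \ u) * H u := by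
  simp only [sum_mul, mul_sum]
  rw [sum_sigma', sum_sigma']
  refine sum_bij' (fun x _ => ⟨s \ x.2, x.1⟩) (fun x _ => ⟨x.2, s \ x.1⟩) ?_ ?_ ?_ ?_ ?_
  · rintro ⟨w, u⟩ h
    simp only [mem_sigma, mem_powerset, subset_sdiff] at h ⊢
    exact ⟨sdiff_subset, h.1, h.2.2.symm⟩
  · rintro ⟨w, u⟩ h
    simp only [mem_sigma, mem_powerset] at h ⊢
    exact ⟨h.2.trans h.1, sdiff_subset_sdiff Subset.rfl h.2⟩
  · rintro ⟨w, u⟩ h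
    simp only [mem_sigma, mem_powerset] at h
    simp [inter_eq_right.2 (h.2.trans sdiff_subset)]
  · rintro ⟨w, u⟩ h
    simp only [mem_sigma, mem_powerset] at h
    simp [inter_eq_right.2 h.1]
  · rintro ⟨w, u⟩ h
    simp only [mem_sigma, mem_powerset] at h
    simp only [Finset.sdiff_sdiff_eq_self (h.2.trans sdiff_subset), sdiff_right_comm s w u]
    ring

theorem sum_derivProdPred_mul_derivProd (s : Finset ι) (a b : R) :
    ∑ w ∈ s.powerset, derivProdPred D f (s \ w) a * derivProd D f w b =
      derivProd D f s (a * b) := by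
  induction s using Finset.strongInduction generalizing a b with
  | H s ih =>
  rcases s.eq_empty_or_nonempty with rfl | ⟨i, his⟩
  · simp [derivProd, derivProdPred]
  obtain ⟨t, hi, rfl⟩ : ∃ t, i ∉ t ∧ insert i t = s :=
    ⟨s.erase i, notMem_erase i s, insert_erase his⟩
  have ih' : ∀ v ⊆ t, ∀ a b : R, ∑ w ∈ v.powerset,
      derivProdPred D f (v \ w) a * derivProd D f w b = derivProd D f v (a * b) :=
    fun v hv => ih v (hv.trans_ssubset (ssubset_insert hi))
  have balance : ∑ w ∈ t.powerset, derivProd D f (t \ w) (D a * f i) * derivProd D f w b =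
      ∑ w ∈ t.powerset, derivProd D f (t \ w) (D a) * derivProd D f w (b * f i) := by
    convert sum_powerset_sdiff_assoc (fun u => derivProd D f u (D a))
      (fun u => derivProdPred D f u (f i)) (fun u => derivProd D f u b) t using 2 with w hw w hw
    · rw [ih' _ sdiff_subset, mul_comm (f i)]
    · rw [ih' _ (mem_powerset.1 hw), mul_comm (f i)]
  rw [sum_powerset_insert hi, derivProd_insert D f hi, mul_assoc, ← ih' t Subset.rfl, map_sum]
  simp only [Derivation.leibniz, smul_eq_mul, derivation_derivProdPred, sum_add_distrib]
  rw [add_comm]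
  congr 1
  · refine sum_congr rfl fun w hw => ?_
    have hiw : i ∉ w := fun h => hi (mem_powerset.1 hw h)
    rw [derivProd_insert D f hiw, insert_sdiff_insert, sdiff_insert_of_notMem hi]
  · simp only [mul_comm (derivProd D f _ (b * f i))]
    rw [← balance]
    refine sum_congr rfl fun w hw => ?_
    have hiw : i ∉ w := fun h => hi (mem_powerset.1 hw h)
    rw [insert_sdiff_of_notMem _ hiw,
      derivProdPred_insert D f (fun h => hi (mem_sdiff.1 h).1)]

end SubsetConvolution

theorem derivation_subset_identity
    {R : Type*} [CommRing R] (δ : R → R)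
    (hadd : ∀ x y : R, δ (x + y) = δ x + δ y)
    (hleibniz : ∀ x y : R, δ (x * y) = x * δ y + y * δ x)
    (M : ℕ) (fA fB : R) (f : ℕ → R) :
    ∑ w ∈ (Finset.Icc 1 M).powerset,
        (if w = Finset.Icc 1 M then fA * δ^[M] (fB * ∏ i ∈ w, f i)
         else
           δ^[M - w.card - 1] (δ fA * ∏ i ∈ Finset.Icc 1 M \ w, f i) *
             δ^[w.card] (fB * ∏ i ∈ w, f i)) =
      δ^[M] (fA * fB * ∏ i ∈ Finset.Icc 1 M, f i) := by
  let D : Derivation ℤ R R := Derivation.mk' (AddMonoidHom.mk' δ hadd).toIntLinearMap hleibniz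
  have hD : ⇑D = δ := rfl
  have key := sum_derivProdPred_mul_derivProd D f (Icc 1 M) fA fB
  have hM : #(Icc 1 M) = M := by simp
  simp only [derivProd, derivProdPred, hD, hM] at key
  rw [← key]
  refine sum_congr rfl fun w hw => ?_
  have hw := mem_powerset.1 hw
  split_ifs with h h' h'
  · rw [h, hM]
  · exact absurd (by simp [h]) h'
  · exact absurd (hw.antisymm (sdiff_eq_empty_iff_subset.1 h')) h
  · rw [card_sdiff_of_subset hw, hM]
end
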